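/- arXiv:1812.00424 — 9 statements merged into one kernel-verified Lean document; each statement's English description precedes it below -/
import Mathlib

section
/- Let T > 0 and let ρ, γ, M be positive real numbers. Let Φ : ℝ → ℝ be a function that is nonnegative on (0,T), Lipschitz continuous on (0,T), and such that for almost every t ∈ (0,T) (with respect to Lebesgue measure) Φ is differentiable at t with derivative satisfying Φ'(t) ≤ −ρ·Φ(t)^{1+γ} + M. Then for every t ∈ (0,T) one has Φ(t) ≤ (1/(γρt))^{1/γ} + (M/ρ)^{1/(1+γ)}. -/
open Set MeasureTheory

/-- An absolutely continuous function starting nonpositive, with nonpositive derivative wherever it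
is positive, stays nonpositive. -/
theorem AbsolutelyContinuousOnInterval.nonpos_of_ae_deriv_nonpos {f : ℝ → ℝ} {a b : ℝ}
    (hab : a ≤ b) (hf : AbsolutelyContinuousOnInterval f a b) (ha : f a ≤ 0)
    (hd : ∀ᵐ x ∂(volume : Measure ℝ), x ∈ Ioc a b → 0 < f x → deriv f x ≤ 0) : f b ≤ 0 := by
  have hc : ContinuousOn f (Icc a b) := by simpa [uIcc_of_le hab] using hf.continuousOn
  have hcomp : IsCompact (Icc a b ∩ f ⁻¹' Iic 0) :=
    isCompact_Icc.of_isClosed_subset (hc.preimage_isClosed_of_isClosed isClosed_Icc isClosed_Iic)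
      inter_subset_left
  obtain ⟨s, ⟨hs, hfs⟩, hmax⟩ := hcomp.exists_isGreatest ⟨a, ⟨le_rfl, hab⟩, ha⟩
  have hsub : AbsolutelyContinuousOnInterval f s b := hf.mono (by
    rw [uIcc_of_le hs.2, uIcc_of_le hab]
    exact Icc_subset_Icc_left hs.1)
  have hint : ∫ x in s..b, deriv f x ≤ 0 := by
    rw [intervalIntegral.integral_of_le hs.2]
    refine setIntegral_nonpos_ae measurableSet_Ioc ?_
    filter_upwards [hd] with x hx hxs
    refine hx ⟨hs.1.trans_lt hxs.1, hxs.2⟩ ?_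
    by_contra hneg
    exact hxs.1.not_ge (hmax ⟨⟨hs.1.trans hxs.1.le, hxs.2⟩, not_lt.mp hneg⟩)
  rw [hsub.integral_deriv_eq_sub] at hint
  have hfs' : f s ≤ 0 := hfs
  linarith

/-- The function `t ↦ (1 / (γ ρ t)) ^ (1 / γ)` solves `y' = -ρ y ^ (1 + γ)` on `(0, ∞)`. -/
theorem hasDerivAt_one_div_mul_rpow {ρ γ t : ℝ} (hρ : 0 < ρ) (hγ : 0 < γ) (ht : 0 < t) :
    HasDerivAt (fun s : ℝ => (1 / (γ * ρ * s)) ^ (1 / γ))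
      (-ρ * ((1 / (γ * ρ * t)) ^ (1 / γ)) ^ (1 + γ)) t := by
  have hpos : 0 < γ * ρ * t := by positivity
  have hlin : HasDerivAt (fun s : ℝ => γ * ρ * s) (γ * ρ) t := by
    simpa using (hasDerivAt_id t).const_mul (γ * ρ)
  have hinv : HasDerivAt (fun s : ℝ => 1 / (γ * ρ * s)) (-(γ * ρ) / (γ * ρ * t) ^ 2) t := by
    simpa only [one_div] using hlin.fun_inv hpos.ne'
  convert hinv.rpow_const (p := 1 / γ) (Or.inl (by positivity)) using 1
  have hu : 0 < 1 / (γ * ρ * t) := by positivity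
  have hexp : 1 / γ * (1 + γ) = (1 / γ - 1) + (2 : ℕ) := by
    push_cast
    field_simp
    ring
  rw [← Real.rpow_mul hu.le, hexp, Real.rpow_add hu, Real.rpow_natCast]
  field_simp

/-- Universal bound for the differential inequality `Φ' ≤ -ρ Φ^{1+γ} + M`
(Ghidaglia-type lemma). -/
theorem stmt_0 (T ρ γ M : ℝ) (hT : 0 < T) (hρ : 0 < ρ) (hγ : 0 < γ) (hM : 0 < M)
    (Φ : ℝ → ℝ)
    (hnn : ∀ t ∈ Ioo (0:ℝ) T, 0 ≤ Φ t)
    (hlip : ∃ K : NNReal, LipschitzOnWith K Φ (Ioo (0:ℝ) T))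
    (hode : ∀ᵐ t ∂(volume : Measure ℝ), t ∈ Ioo (0:ℝ) T →
      ∃ d : ℝ, HasDerivAt Φ d t ∧ d ≤ -ρ * Φ t ^ (1 + γ) + M) :
    ∀ t ∈ Ioo (0:ℝ) T,
      Φ t ≤ (1 / (γ * ρ * t)) ^ (1 / γ) + (M / ρ) ^ (1 / (1 + γ)) := by
  obtain ⟨K, hK⟩ := hlip
  intro t ht
  have hp : 0 < 1 + γ := by linarith
  set c : ℝ := (M / ρ) ^ (1 / (1 + γ)) with hc
  have hc0 : 0 ≤ c := by positivity
  have hcM : ρ * c ^ (1 + γ) = M := by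
    rw [hc, ← Real.rpow_mul (by positivity), one_div_mul_cancel hp.ne', Real.rpow_one]
    field_simp
  set g : ℝ → ℝ := fun s => (1 / (γ * ρ * s)) ^ (1 / γ) with hg
  set B : ℝ := Φ t + K * T + 1 with hB
  have hB0 : 0 < B := by
    have := hnn t ht
    positivity
  have hΦB : ∀ s ∈ Ioo (0:ℝ) T, Φ s ≤ B := by
    intro s hs
    have h1 := hK.dist_le_mul s hs t ht
    rw [Real.dist_eq, Real.dist_eq] at h1
    have h2 : |s - t| ≤ T := abs_le.mpr ⟨by linarith [hs.1, ht.2], by linarith [hs.2, ht.1]⟩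
    have h3 := mul_le_mul_of_nonneg_left h2 K.coe_nonneg
    linarith [le_abs_self (Φ s - Φ t)]
  set a : ℝ := min t (1 / (γ * ρ * B ^ γ)) with ha
  have ha0 : 0 < a := lt_min ht.1 (by positivity)
  have hat : a ≤ t := min_le_left _ _
  have hIcc : Icc a t ⊆ Ioo 0 T := fun x hx => ⟨ha0.trans_le hx.1, hx.2.trans_lt ht.2⟩
  have hga : B ≤ g a := by
    have h1 : B ^ γ ≤ 1 / (γ * ρ * a) := by
      have h2 : a ≤ 1 / (γ * ρ * B ^ γ) := min_le_right _ _
      rw [le_div_iff₀ (by positivity)] at h2 ⊢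
      linarith
    calc B = (B ^ γ) ^ (1 / γ) := by
          rw [← Real.rpow_mul hB0.le, mul_one_div_cancel hγ.ne', Real.rpow_one]
      _ ≤ g a := Real.rpow_le_rpow (by positivity) h1 (by positivity)
  have hgac : AbsolutelyContinuousOnInterval (fun s => g s + c) a t := by
    refine ContDiffOn.absolutelyContinuousOnInterval ?_
    rw [uIcc_of_le hat]
    intro x hx
    have hx0 : 0 < γ * ρ * x := mul_pos (by positivity) (hIcc hx).1
    refine ContDiffAt.contDiffWithinAt (ContDiffAt.add ?_ contDiffAt_const)
    refine ContDiffAt.rpow_const_of_ne ?_ (by positivity)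
    exact contDiffAt_const.div (contDiffAt_const.mul contDiffAt_id) hx0.ne'
  have hΦac : AbsolutelyContinuousOnInterval Φ a t :=
    (hK.mono (by rwa [uIcc_of_le hat])).absolutelyContinuousOnInterval
  have key := (hΦac.sub hgac).nonpos_of_ae_deriv_nonpos hat
    (by simpa using (hΦB a (hIcc ⟨le_rfl, hat⟩)).trans (by linarith)) (by
      filter_upwards [hode] with x hx hxI hpos
      have hxT := hIcc (Ioc_subset_Icc_self hxI)
      obtain ⟨d, hd, hdle⟩ := hx hxT
      have hgd : HasDerivAt (fun s => g s + c) (-ρ * g x ^ (1 + γ)) x :=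
        (hasDerivAt_one_div_mul_rpow hρ hγ hxT.1).add_const c
      rw [(hd.sub hgd).deriv]
      have hpos' : 0 < Φ x - (g x + c) := hpos
      have hg0 : 0 ≤ g x := Real.rpow_nonneg (by have := hxT.1; positivity) _
      have h1 := Real.add_rpow_le_rpow_add hg0 hc0 (by linarith : 1 ≤ 1 + γ)
      have h2 : (g x + c) ^ (1 + γ) ≤ Φ x ^ (1 + γ) :=
        Real.rpow_le_rpow (by positivity) (by linarith) hp.le
      have h3 := mul_le_mul_of_nonneg_left (h1.trans h2) hρ.le
      linarith)
  have key' : Φ t - (g t + c) ≤ 0 := key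
  linarith
end

section
/- Let ρ, γ, M be positive real numbers and define Ψ(t) = (1/(γρt))^{1/γ} + (M/ρ)^{1/(1+γ)} for t > 0. Then Ψ is differentiable on (0,∞) and satisfies Ψ'(t) + ρ·Ψ(t)^{1+γ} ≥ M for every t > 0. -/
/-- The comparison function `Ψ(t) = (1/(γρt))^{1/γ} + (M/ρ)^{1/(1+γ)}` is differentiable
on `(0,∞)` and satisfies `Ψ' + ρ Ψ^{1+γ} ≥ M` there. -/
theorem stmt_1 (ρ γ M : ℝ) (hρ : 0 < ρ) (hγ : 0 < γ) (hM : 0 < M) :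
    ∀ t > (0:ℝ),
      DifferentiableAt ℝ
        (fun s : ℝ => (1 / (γ * ρ * s)) ^ (1 / γ) + (M / ρ) ^ (1 / (1 + γ))) t ∧
      deriv (fun s : ℝ => (1 / (γ * ρ * s)) ^ (1 / γ) + (M / ρ) ^ (1 / (1 + γ))) t
          + ρ * ((1 / (γ * ρ * t)) ^ (1 / γ) + (M / ρ) ^ (1 / (1 + γ))) ^ (1 + γ) ≥ M := by
  intro t ht
  have hu : 0 < 1 / (γ * ρ * t) := by positivity
  have hd_inner : HasDerivAt (fun s : ℝ => 1 / (γ * ρ * s))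
      (-(γ * ρ * (1 / (γ * ρ * t)) ^ 2)) t := by
    have hne : γ * ρ * t ≠ 0 := by positivity
    have h := ((hasDerivAt_id' t).const_mul (γ * ρ)).fun_inv hne
    simp only [one_div]
    refine h.congr_deriv ?_
    field_simp
  have hd : HasDerivAt
      (fun s : ℝ => (1 / (γ * ρ * s)) ^ (1 / γ) + (M / ρ) ^ (1 / (1 + γ)))
      (-(ρ * (1 / (γ * ρ * t)) ^ (1 / γ + 1))) t := by
    refine ((hd_inner.rpow_const (p := 1 / γ) (Or.inl hu.ne')).add_const
      ((M / ρ) ^ (1 / (1 + γ)))).congr_deriv ?_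
    have e : (1 / (γ * ρ * t)) ^ (1 / γ + 1)
        = (1 / (γ * ρ * t)) ^ (1 / γ - 1) * (1 / (γ * ρ * t)) ^ 2 := by
      rw [← Real.rpow_natCast, ← Real.rpow_add hu]
      congr 1
      push_cast
      ring
    rw [e]
    generalize (1 / (γ * ρ * t)) ^ (1 / γ - 1) = v
    field_simp
  refine ⟨hd.differentiableAt, ?_⟩
  rw [hd.deriv]
  have hsup := Real.add_rpow_le_rpow_add (p := 1 + γ)
    (Real.rpow_nonneg hu.le (1 / γ))
    (Real.rpow_nonneg (div_pos hM hρ).le (1 / (1 + γ))) (by linarith)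
  have e₁ : ((1 / (γ * ρ * t)) ^ (1 / γ)) ^ (1 + γ) = (1 / (γ * ρ * t)) ^ (1 / γ + 1) := by
    rw [← Real.rpow_mul hu.le]
    congr 1
    field_simp
  have e₂ : ((M / ρ) ^ (1 / (1 + γ))) ^ (1 + γ) = M / ρ := by
    rw [← Real.rpow_mul (div_pos hM hρ).le, one_div_mul_cancel (by positivity), Real.rpow_one]
  rw [e₁, e₂] at hsup
  have h := mul_le_mul_of_nonneg_left hsup hρ.le
  rw [mul_add, mul_div_cancel₀ M hρ.ne'] at h
  linarith
end

section
/- Assume 0 < α < β, assume hypotheses (F2), (F3), (G2), (G3) hold with C₁ = C₂ = C₃ = C₄ = 0, and set γ = max{α/2, (β−α)/((α+1)(β+2))}. Then there exists a real number D (depending only on α, β, the constants δ₁, δ₂, δ₃, D₄ and the operator norms of the embedding maps, but not on the solution) such that for every classical solution u of u'' + ∇F(u) + g(t,u') = 0 on (0,∞) one has ‖i(u'(t))‖_H² + F(u(t)) ≤ D·t^{−1/γ} for every t ≥ 1. -/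
open Set RealInnerProductSpace

lemma exists_rpow_le_add_mul_rpow {r m η : ℝ} (hr : 0 < r) (hrm : r < m) (hη : 0 < η) :
    ∃ A : ℝ, 0 ≤ A ∧ ∀ b : ℝ, 0 ≤ b → b ^ r ≤ η + A * b ^ m := by
  refine ⟨(η ^ r⁻¹) ^ (r - m), by positivity, fun b hb => ?_⟩
  have hpos : 0 < η ^ r⁻¹ := Real.rpow_pos_of_pos hη _
  rcases le_total b (η ^ r⁻¹) with h | h
  · have h1 : b ^ r ≤ (η ^ r⁻¹) ^ r := Real.rpow_le_rpow hb h hr.le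
    rw [Real.rpow_inv_rpow hη.le hr.ne'] at h1
    have : 0 ≤ (η ^ r⁻¹) ^ (r - m) * b ^ m := by positivity
    linarith
  · have hb' : 0 < b := hpos.trans_le h
    have h1 : b ^ (r - m) ≤ (η ^ r⁻¹) ^ (r - m) :=
      Real.rpow_le_rpow_of_nonpos hpos h (by linarith)
    have h2 : b ^ r = b ^ (r - m) * b ^ m := by
      rw [← Real.rpow_add hb']; congr 1; ring
    have h3 : b ^ (r - m) * b ^ m ≤ (η ^ r⁻¹) ^ (r - m) * b ^ m := by gcongr
    linarith

/-- A positive solution of `Φ' ≤ -c Φ ^ (1 + s)` satisfies a decay bound which is independent of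
its initial value. -/
lemma le_rpow_of_hasDerivAt_le {Φ Φ' : ℝ → ℝ} {t₀ t₁ s c : ℝ} (ht : t₀ < t₁) (hs : 0 < s)
    (hc : 0 < c) (hpos : ∀ t ∈ Icc t₀ t₁, 0 < Φ t)
    (hd : ∀ t ∈ Icc t₀ t₁, HasDerivAt Φ (Φ' t) t)
    (hle : ∀ t ∈ Icc t₀ t₁, Φ' t ≤ -c * Φ t ^ (1 + s)) :
    Φ t₁ ≤ (s * c * (t₁ - t₀)) ^ (-(1 / s)) := by
  have hder : ∀ t ∈ Icc t₀ t₁, HasDerivAt (fun x => Φ x ^ (-s) - s * c * x)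
      (Φ' t * (-s) * Φ t ^ (-s - 1) - s * c) t := by
    intro t h
    have h1 := (hd t h).rpow_const (p := -s) (Or.inl (hpos t h).ne')
    have h2 := (hasDerivAt_id t).const_mul (s * c)
    exact (h1.sub h2).congr_deriv (by rw [mul_one])
  have hmono : MonotoneOn (fun x => Φ x ^ (-s) - s * c * x) (Icc t₀ t₁) := by
    refine monotoneOn_of_hasDerivWithinAt_nonneg (convex_Icc _ _)
      (fun t h => (hder t h).continuousAt.continuousWithinAt)
      (fun t h => (hder t (interior_subset h)).hasDerivWithinAt) ?_
    intro t h
    have h' := interior_subset h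
    have hp := hpos t h'
    have hprod : Φ t ^ (1 + s) * Φ t ^ (-s - 1) = 1 := by
      rw [← Real.rpow_add hp]; ring_nf; simp
    have h3 : Φ' t * Φ t ^ (-s - 1) ≤ -c * Φ t ^ (1 + s) * Φ t ^ (-s - 1) :=
      mul_le_mul_of_nonneg_right (hle t h') (by positivity)
    have h4 : Φ' t * Φ t ^ (-s - 1) ≤ -c := by
      rw [mul_assoc, hprod] at h3; linarith
    nlinarith
  have h1 := hmono (left_mem_Icc.2 ht.le) (right_mem_Icc.2 ht.le) ht.le
  have h0 : 0 < Φ t₀ ^ (-s) := Real.rpow_pos_of_pos (hpos _ (left_mem_Icc.2 ht.le)) _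
  have h2 : s * c * (t₁ - t₀) ≤ Φ t₁ ^ (-s) := by
    simp only at h1; linarith
  have hp1 := hpos _ (right_mem_Icc.2 ht.le)
  have h3 : 0 < s * c * (t₁ - t₀) := mul_pos (mul_pos hs hc) (by linarith)
  have h4 := Real.rpow_le_rpow_of_nonpos h3 h2 (z := -(1 / s)) (by
    have := one_div_pos.2 hs; linarith)
  rwa [← Real.rpow_mul hp1.le, show -s * -(1 / s) = 1 by field_simp, Real.rpow_one] at h4

/-- The pointwise estimate behind the decay of the modified energy `E + ε E ^ s p`. -/
lemma exists_modified_energy_estimate {α q s K δ₂ δ₃ c₃ c₄ c₅ : ℝ} (hα : 0 < α) (hs : 0 < s)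
    (hK : 1 ≤ K) (hδ₂ : 0 < δ₂) (hδ₃ : 0 < δ₃) (hc₃ : 0 ≤ c₃) (hc₄ : 0 ≤ c₄) (hc₅ : 0 ≤ c₅) :
    ∃ ε c : ℝ, 0 < ε ∧ 0 < c ∧ ∀ E a Q p P : ℝ, 0 < E → 0 ≤ a → δ₃ * a ^ (α + 2) ≤ Q →
      |p| ≤ c₃ * E ^ (q + 1 / 2) →
      P ≤ -δ₂ * E + c₅ * a ^ (2 : ℝ) + c₄ * a ^ (α + 1) * E ^ q →
      E ^ (s - α / 2) ≤ K → E ^ (s - (1 - q * (α + 2)) / (α + 1)) ≤ K →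
      E ^ (s - (1 / 2 - q)) ≤ K →
      E / 2 ≤ E + ε * (E ^ s * p) ∧
      -Q + ε * (-Q * s * E ^ (s - 1) * p + E ^ s * P) ≤ -c * (E + ε * (E ^ s * p)) ^ (1 + s) := by
  obtain ⟨A₁, hA₁, hy₁⟩ := exists_rpow_le_add_mul_rpow (r := 2) (m := α + 2)
    (η := δ₂ / 4 / (c₅ * K + 1)) (by norm_num) (by linarith) (by positivity)
  obtain ⟨A₂, hA₂, hy₂⟩ := exists_rpow_le_add_mul_rpow (r := α + 1) (m := α + 2)
    (η := δ₂ / 4 / (c₄ * K + 1)) (by linarith) (by linarith) (by positivity)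
  set A := c₅ * K * A₁ + c₄ * K * A₂ with hA
  have hA0 : 0 ≤ A := by positivity
  have hyoung : ∀ b : ℝ, 0 ≤ b →
      c₅ * K * b ^ (2 : ℝ) + c₄ * K * b ^ (α + 1) ≤ δ₂ / 2 + A * b ^ (α + 2) := by
    intro b hb
    have e₁ := mul_le_mul_of_nonneg_left (hy₁ b hb) (show 0 ≤ c₅ * K by positivity)
    have e₂ := mul_le_mul_of_nonneg_left (hy₂ b hb) (show 0 ≤ c₄ * K by positivity)
    have f : ∀ x : ℝ, 0 ≤ x → x * (δ₂ / 4 / (x + 1)) ≤ δ₂ / 4 := by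
      intro x hx
      rw [← mul_div_assoc, div_le_iff₀ (by linarith)]
      nlinarith
    have f₁ := f (c₅ * K) (by positivity)
    have f₂ := f (c₄ * K) (by positivity)
    rw [hA]; linarith
  set M := 2 * (c₃ * K + s * c₃ * K + A / δ₃ + 1) with hM
  have hcK : 0 ≤ c₃ * K := by positivity
  have hscK : 0 ≤ s * c₃ * K := by positivity
  have hAd : 0 ≤ A / δ₃ := by positivity
  have hM0 : 0 < M := by rw [hM]; linarith
  have hε : 0 < M⁻¹ := inv_pos.2 hM0
  have key : ∀ x : ℝ, 2 * x ≤ M → M⁻¹ * x ≤ 1 / 2 := by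
    intro x hx
    rw [inv_mul_le_iff₀ hM0]; linarith
  have k₁ := key (c₃ * K) (by linarith)
  have k₂ := key (s * c₃ * K) (by linarith)
  have k₃ := key (A / δ₃) (by linarith)
  generalize M⁻¹ = ε at *
  have k₃' : ε * A ≤ δ₃ / 2 := by
    rw [← mul_div_assoc, div_le_iff₀ hδ₃] at k₃; linarith
  refine ⟨ε, ε * (δ₂ / 2) / 2 ^ (1 + s), hε, by positivity, ?_⟩
  intro E a Q p P hE ha hQ hp hP hE₁ hE₂ hE₃
  have hQ0 : 0 ≤ Q := le_trans (by positivity) hQ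
  have hs1 : E ^ (s - 1) * |p| ≤ c₃ * K := by
    calc E ^ (s - 1) * |p| ≤ E ^ (s - 1) * (c₃ * E ^ (q + 1 / 2)) := by gcongr
      _ = c₃ * E ^ (s - (1 / 2 - q)) := by
        rw [mul_left_comm, ← Real.rpow_add hE]; congr 2; ring
      _ ≤ c₃ * K := by gcongr
  have hEs : E ^ s = E ^ (s - 1) * E := by
    rw [Real.rpow_sub_one hE.ne']; field_simp
  have hs0 : ε * |E ^ s * p| ≤ E / 2 := by
    rw [abs_mul, abs_of_nonneg (by positivity), hEs]
    calc ε * (E ^ (s - 1) * E * |p|) = ε * (E ^ (s - 1) * |p|) * E := by ring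
      _ ≤ ε * (c₃ * K) * E := by gcongr
      _ ≤ 1 / 2 * E := by gcongr
      _ = E / 2 := by ring
  have hb1 : -(E / 2) ≤ ε * (E ^ s * p) := by
    have := mul_le_mul_of_nonneg_left (neg_abs_le (E ^ s * p)) hε.le
    linarith
  have hb2 : ε * (E ^ s * p) ≤ E / 2 := by
    have := mul_le_mul_of_nonneg_left (le_abs_self (E ^ s * p)) hε.le
    linarith
  refine ⟨by linarith, ?_⟩
  set T := E ^ (1 + s) with hT
  have hT0 : 0 < T := Real.rpow_pos_of_pos hE _
  have hΦ : (E + ε * (E ^ s * p)) ^ (1 + s) ≤ 2 ^ (1 + s) * T := by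
    rw [hT, ← Real.mul_rpow (by norm_num) hE.le]
    exact Real.rpow_le_rpow (by linarith) (by linarith) (by linarith)
  have hcΦ : ε * (δ₂ / 2) / 2 ^ (1 + s) * (E + ε * (E ^ s * p)) ^ (1 + s) ≤ ε * (δ₂ / 2) * T := by
    calc _ ≤ ε * (δ₂ / 2) / 2 ^ (1 + s) * (2 ^ (1 + s) * T) := by gcongr
      _ = _ := by field_simp
  have hQp : ε * (-Q * s * E ^ (s - 1) * p) ≤ Q / 2 := by
    calc ε * (-Q * s * E ^ (s - 1) * p) = ε * Q * s * E ^ (s - 1) * (-p) := by ring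
      _ ≤ ε * Q * s * E ^ (s - 1) * |p| := by gcongr; exact neg_le_abs p
      _ = ε * Q * s * (E ^ (s - 1) * |p|) := by ring
      _ ≤ ε * Q * s * (c₃ * K) := by gcongr
      _ = Q * (ε * (s * c₃ * K)) := by ring
      _ ≤ Q * (1 / 2) := by gcongr
      _ = Q / 2 := by ring
  -- rescale `a` by the homogeneity of the energy inequality
  obtain ⟨b, hb, rfl⟩ : ∃ b : ℝ, 0 ≤ b ∧ a = b * E ^ ((1 + s) / (α + 2)) :=
    ⟨a / E ^ ((1 + s) / (α + 2)), by positivity, by field_simp⟩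
  have hpow : ∀ r : ℝ, (b * E ^ ((1 + s) / (α + 2))) ^ r
      = b ^ r * E ^ ((1 + s) / (α + 2) * r) := fun r => by
    rw [Real.mul_rpow hb (by positivity), ← Real.rpow_mul hE.le]
  have hle : ∀ x θ : ℝ, E ^ x ≤ K → 0 ≤ θ → θ ≤ 1 → E ^ (x * θ) ≤ K := by
    intro x θ hx h0 h1
    rw [Real.rpow_mul hE.le]
    calc (E ^ x) ^ θ ≤ K ^ θ := by gcongr
      _ ≤ K ^ (1 : ℝ) := Real.rpow_le_rpow_of_exponent_le hK h1
      _ = K := Real.rpow_one K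
  have hα2 : 0 < α + 2 := by linarith
  have hα1 : 0 < α + 1 := by linarith
  have g₁ : E ^ s * (b * E ^ ((1 + s) / (α + 2))) ^ (2 : ℝ) ≤ T * (K * b ^ (2 : ℝ)) := by
    have h := hle (s - α / 2) (2 / (α + 2)) hE₁ (by positivity)
      (by rw [div_le_one hα2]; linarith)
    rw [hpow]
    calc E ^ s * (b ^ (2 : ℝ) * E ^ ((1 + s) / (α + 2) * 2))
        = b ^ (2 : ℝ) * (E ^ s * E ^ ((1 + s) / (α + 2) * 2)) := by ring
      _ = b ^ (2 : ℝ) * (T * E ^ ((s - α / 2) * (2 / (α + 2)))) := by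
        rw [hT, ← Real.rpow_add hE, ← Real.rpow_add hE]; congr 2; field_simp; ring
      _ ≤ b ^ (2 : ℝ) * (T * K) := by gcongr
      _ = _ := by ring
  have g₂ : E ^ s * ((b * E ^ ((1 + s) / (α + 2))) ^ (α + 1) * E ^ q)
      ≤ T * (K * b ^ (α + 1)) := by
    have h := hle (s - (1 - q * (α + 2)) / (α + 1)) ((α + 1) / (α + 2)) hE₂ (by positivity)
      (by rw [div_le_one hα2]; linarith)
    rw [hpow]
    calc E ^ s * (b ^ (α + 1) * E ^ ((1 + s) / (α + 2) * (α + 1)) * E ^ q)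
        = b ^ (α + 1) * (E ^ s * E ^ ((1 + s) / (α + 2) * (α + 1)) * E ^ q) := by ring
      _ = b ^ (α + 1) * (T * E ^ ((s - (1 - q * (α + 2)) / (α + 1)) * ((α + 1) / (α + 2)))) := by
        rw [hT, ← Real.rpow_add hE, ← Real.rpow_add hE, ← Real.rpow_add hE]
        congr 2; field_simp; ring
      _ ≤ b ^ (α + 1) * (T * K) := by gcongr
      _ = _ := by ring
  have g₃ : E ^ s * E = T := by
    rw [hT, add_comm, Real.rpow_add_one hE.ne']
  have g₄ : (b * E ^ ((1 + s) / (α + 2))) ^ (α + 2) = T * b ^ (α + 2) := by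
    rw [hpow, div_mul_cancel₀ _ hα2.ne', mul_comm]
  rw [g₄] at hQ
  have hPT : E ^ s * P ≤ T * (-(δ₂ / 2) + A * b ^ (α + 2)) := by
    have h1 := mul_le_mul_of_nonneg_left hP (show 0 ≤ E ^ s by positivity)
    have h2 := mul_le_mul_of_nonneg_left g₁ hc₅
    have h3 := mul_le_mul_of_nonneg_left g₂ hc₄
    have h4 := mul_le_mul_of_nonneg_left (hyoung b hb) hT0.le
    calc E ^ s * P ≤ _ := h1
      _ = -δ₂ * (E ^ s * E) + c₅ * (E ^ s * (b * E ^ ((1 + s) / (α + 2))) ^ (2 : ℝ))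
          + c₄ * (E ^ s * ((b * E ^ ((1 + s) / (α + 2))) ^ (α + 1) * E ^ q)) := by ring
      _ ≤ _ := by rw [g₃]; linarith
  have h5 := mul_le_mul_of_nonneg_left hPT hε.le
  have h6 : ε * A * (T * b ^ (α + 2)) ≤ δ₃ / 2 * (T * b ^ (α + 2)) := by gcongr
  linarith

/-- Decay of a scalar energy `E` on an interval, by means of the functional `E + ε E ^ s p`. -/
lemma exists_energy_decay {α q s K δ₂ δ₃ c₃ c₄ c₅ : ℝ} (hα : 0 < α) (hs : 0 < s)
    (hK : 1 ≤ K) (hδ₂ : 0 < δ₂) (hδ₃ : 0 < δ₃) (hc₃ : 0 ≤ c₃) (hc₄ : 0 ≤ c₄) (hc₅ : 0 ≤ c₅) :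
    ∃ D : ℝ, 0 ≤ D ∧ ∀ (E a Q p P : ℝ → ℝ) (t₀ t₁ : ℝ), t₀ < t₁ →
      (∀ t ∈ Icc t₀ t₁, HasDerivAt E (-Q t) t) →
      (∀ t ∈ Icc t₀ t₁, HasDerivAt p (P t) t) →
      (∀ t ∈ Icc t₀ t₁, 0 < E t) →
      (∀ t ∈ Icc t₀ t₁, 0 ≤ a t) →
      (∀ t ∈ Icc t₀ t₁, δ₃ * a t ^ (α + 2) ≤ Q t) →
      (∀ t ∈ Icc t₀ t₁, |p t| ≤ c₃ * E t ^ (q + 1 / 2)) →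
      (∀ t ∈ Icc t₀ t₁,
        P t ≤ -δ₂ * E t + c₅ * a t ^ (2 : ℝ) + c₄ * a t ^ (α + 1) * E t ^ q) →
      (∀ t ∈ Icc t₀ t₁, E t ^ (s - α / 2) ≤ K) →
      (∀ t ∈ Icc t₀ t₁, E t ^ (s - (1 - q * (α + 2)) / (α + 1)) ≤ K) →
      (∀ t ∈ Icc t₀ t₁, E t ^ (s - (1 / 2 - q)) ≤ K) →
      E t₁ ≤ D * (t₁ - t₀) ^ (-(1 / s)) := by
  obtain ⟨ε, c, hε, hc, h⟩ := exists_modified_energy_estimate (q := q) hα hs hK hδ₂ hδ₃ hc₃ hc₄ hc₅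
  refine ⟨2 * (s * c) ^ (-(1 / s)), by positivity, ?_⟩
  intro E a Q p P t₀ t₁ ht hE hp hpos ha hQ hpb hP h₁ h₂ h₃
  have hh := fun t (m : t ∈ Icc t₀ t₁) => h (E t) (a t) (Q t) (p t) (P t) (hpos t m) (ha t m)
    (hQ t m) (hpb t m) (hP t m) (h₁ t m) (h₂ t m) (h₃ t m)
  have hfin := le_rpow_of_hasDerivAt_le (Φ := fun t => E t + ε * (E t ^ s * p t))
    (Φ' := fun t => -Q t + ε * (-Q t * s * E t ^ (s - 1) * p t + E t ^ s * P t)) ht hs hc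
    (fun t m => lt_of_lt_of_le (half_pos (hpos t m)) (hh t m).1)
    (fun t m => (hE t m).add
      ((((hE t m).rpow_const (Or.inl (hpos t m).ne')).mul (hp t m)).const_mul ε))
    (fun t m => (hh t m).2)
  have hlow := (hh t₁ (right_mem_Icc.2 ht.le)).1
  rw [Real.mul_rpow (mul_pos hs hc).le (by linarith)] at hfin
  linarith

/-- Two-step decay: a universal bound by the smallest of the exponents, then the decay rate
given by the largest of them. -/
lemma exists_universal_energy_decay {α β δ₂ δ₃ c₃ c₄ c₅ : ℝ} (hα : 0 < α) (hαβ : α < β)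
    (hδ₂ : 0 < δ₂) (hδ₃ : 0 < δ₃) (hc₃ : 0 ≤ c₃) (hc₄ : 0 ≤ c₄) (hc₅ : 0 ≤ c₅) :
    ∃ D : ℝ, 0 ≤ D ∧ ∀ E a Q p P : ℝ → ℝ,
      (∀ t ∈ Ioi (0 : ℝ), HasDerivAt E (-Q t) t) →
      (∀ t ∈ Ioi (0 : ℝ), HasDerivAt p (P t) t) →
      (∀ t ∈ Ioi (0 : ℝ), 0 ≤ a t) →
      (∀ t ∈ Ioi (0 : ℝ), δ₃ * a t ^ (α + 2) ≤ Q t) →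
      (∀ t ∈ Ioi (0 : ℝ), |p t| ≤ c₃ * E t ^ ((β + 2)⁻¹ + 1 / 2)) →
      (∀ t ∈ Ioi (0 : ℝ),
        P t ≤ -δ₂ * E t + c₅ * a t ^ (2 : ℝ) + c₄ * a t ^ (α + 1) * E t ^ (β + 2)⁻¹) →
      ∀ t ≥ (1 : ℝ),
        E t ≤ D * t ^ (-(1 / max (α / 2) ((β - α) / ((α + 1) * (β + 2))))) := by
  have hα1 : 0 < α + 1 := by linarith
  have hβ2 : 0 < β + 2 := by linarith
  have hx₂ : (1 - (β + 2)⁻¹ * (α + 2)) / (α + 1) = (β - α) / ((α + 1) * (β + 2)) := by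
    field_simp; ring
  set x₁ := α / 2 with hx₁
  set x₂ := (β - α) / ((α + 1) * (β + 2)) with hx₂d
  set x₃ := 1 / 2 - (β + 2)⁻¹ with hx₃
  have h₁0 : 0 < x₁ := by positivity
  have h₂0 : 0 < x₂ := div_pos (by linarith) (by positivity)
  have hx₃' : x₃ = β / (2 * (β + 2)) := by rw [hx₃]; field_simp; ring
  have hmid : min x₁ x₂ ≤ x₃ ∧ x₃ ≤ max x₁ x₂ := by
    have hc : (α + 1) * x₂ + x₁ = (α + 1 + 1) * x₃ := by
      rw [hx₃', hx₂d, hx₁]; field_simp; ring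
    constructor
    · by_contra! hlt
      obtain ⟨l₁, l₂⟩ := lt_min_iff.1 hlt
      nlinarith
    · by_contra! hlt
      obtain ⟨l₁, l₂⟩ := max_lt_iff.1 hlt
      nlinarith
  obtain ⟨B, hB, hdec₁⟩ := exists_energy_decay (q := (β + 2)⁻¹) (s := min x₁ x₂) (K := 1) hα
    (lt_min h₁0 h₂0) le_rfl hδ₂ hδ₃ hc₃ hc₄ hc₅
  set R := max 1 (B * ((1 : ℝ) / 2 - 1 / 4) ^ (-(1 / min x₁ x₂))) with hR
  have hR1 : 1 ≤ R := le_max_left _ _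
  set γ := max x₁ x₂ with hγ
  have hγ0 : 0 < γ := lt_max_of_lt_left h₁0
  obtain ⟨D, hD, hdec₂⟩ := exists_energy_decay (q := (β + 2)⁻¹) (s := γ) (K := R ^ γ) hα
    hγ0 (Real.one_le_rpow hR1 hγ0.le) hδ₂ hδ₃ hc₃ hc₄ hc₅
  rw [hx₂] at hdec₁ hdec₂
  refine ⟨D * (1 / 2) ^ (-(1 / γ)), by positivity, ?_⟩
  intro E a Q p P hE hp ha hQ hpb hP t ht
  have hanti : AntitoneOn E (Ioi 0) := by
    refine antitoneOn_of_hasDerivWithinAt_nonpos (f' := fun t => -Q t) (convex_Ioi _)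
      (fun t h => (hE t h).continuousAt.continuousWithinAt)
      (fun t h => (hE t (interior_subset h)).hasDerivWithinAt) ?_
    intro t h
    have h' := interior_subset h
    have := hQ t h'
    have := Real.rpow_nonneg (ha t h') (α + 2)
    have : 0 ≤ δ₃ * a t ^ (α + 2) := by positivity
    linarith
  have hbound : E (1 / 2) ≤ R := by
    by_contra! hlt
    have hsub : ∀ r ∈ Icc (1 / 4 : ℝ) (1 / 2), r ∈ Ioi (0 : ℝ) :=
      fun r hr => lt_of_lt_of_le (by norm_num) hr.1
    have hge : ∀ r ∈ Icc (1 / 4 : ℝ) (1 / 2), 1 ≤ E r := fun r hr =>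
      (hR1.trans hlt.le).trans (hanti (hsub r hr) (by norm_num) hr.2)
    have := hdec₁ E a Q p P (1 / 4) (1 / 2) (by norm_num) (fun r hr => hE r (hsub r hr))
      (fun r hr => hp r (hsub r hr)) (fun r hr => one_pos.trans_le (hge r hr))
      (fun r hr => ha r (hsub r hr)) (fun r hr => hQ r (hsub r hr))
      (fun r hr => hpb r (hsub r hr)) (fun r hr => hP r (hsub r hr))
      (fun r hr => Real.rpow_le_one_of_one_le_of_nonpos (hge r hr)
        (by linarith [min_le_left x₁ x₂]))
      (fun r hr => Real.rpow_le_one_of_one_le_of_nonpos (hge r hr)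
        (by linarith [min_le_right x₁ x₂]))
      (fun r hr => Real.rpow_le_one_of_one_le_of_nonpos (hge r hr) (by linarith [hmid.1]))
    exact absurd (this.trans (le_max_right _ _)) (not_le.2 hlt)
  have ht0 : (0 : ℝ) < t := by linarith
  rcases le_or_gt (E t) 0 with h0 | h0
  · exact h0.trans (by positivity)
  have hsub : ∀ r ∈ Icc (1 / 2 : ℝ) t, r ∈ Ioi (0 : ℝ) :=
    fun r hr => lt_of_lt_of_le (by norm_num) hr.1
  have hEpos : ∀ r ∈ Icc (1 / 2 : ℝ) t, 0 < E r := fun r hr =>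
    h0.trans_le (hanti (hsub r hr) ht0 hr.2)
  have hK : ∀ x : ℝ, 0 ≤ x → x ≤ γ → ∀ r ∈ Icc (1 / 2 : ℝ) t, E r ^ (γ - x) ≤ R ^ γ := by
    intro x hx hxγ r hr
    have hER : E r ≤ R := (hanti (by norm_num) (hsub r hr) hr.1).trans hbound
    calc E r ^ (γ - x) ≤ R ^ (γ - x) :=
          Real.rpow_le_rpow (hEpos r hr).le hER (by linarith)
      _ ≤ R ^ γ := Real.rpow_le_rpow_of_exponent_le hR1 (by linarith)
  have hx₃0 : 0 ≤ x₃ := by rw [hx₃']; exact div_nonneg (by linarith) (by linarith)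
  have hlast := hdec₂ E a Q p P (1 / 2) t (by linarith) (fun r hr => hE r (hsub r hr))
    (fun r hr => hp r (hsub r hr)) hEpos
    (fun r hr => ha r (hsub r hr)) (fun r hr => hQ r (hsub r hr))
    (fun r hr => hpb r (hsub r hr)) (fun r hr => hP r (hsub r hr))
    (hK x₁ h₁0.le (le_max_left _ _)) (hK x₂ h₂0.le (le_max_right _ _)) (hK x₃ hx₃0 hmid.2)
  have hcmp : (t - 1 / 2) ^ (-(1 / γ)) ≤ (1 / 2 * t) ^ (-(1 / γ)) :=
    Real.rpow_le_rpow_of_nonpos (by positivity) (by linarith)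
      (by have := one_div_pos.2 hγ0; linarith)
  rw [Real.mul_rpow (by norm_num) ht0.le] at hcmp
  calc E t ≤ _ := hlast
    _ ≤ D * ((1 / 2) ^ (-(1 / γ)) * t ^ (-(1 / γ))) := by gcongr
    _ = _ := by ring

/-- Universal decay under standard assumptions (Theorem 3.3 of the paper): under
assumptions (F2)-(F3)-(G2)-(G3) with `C₁ = C₂ = C₃ = C₄ = 0`, in the regime
`0 < α < β`, with `γ = max {α/2, (β-α)/((α+1)(β+2))}`, there exists a constant `D`,
independent of the solution, such that every classical solution of
`u'' + ∇F(u) + g(t,u') = 0` on `(0,∞)` satisfies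
`‖u'(t)‖_H² + F(u(t)) ≤ D t^{-1/γ}` for all `t ≥ 1`. -/
theorem stmt_3
    (V H X Y : Type*)
    [NormedAddCommGroup V] [InnerProductSpace ℝ V]
    [NormedAddCommGroup H] [InnerProductSpace ℝ H]
    [NormedAddCommGroup X] [NormedSpace ℝ X]
    [NormedAddCommGroup Y] [NormedSpace ℝ Y]
    -- chain of continuous embeddings V ⊆ Y ⊆ X ⊆ H
    (iVY : V →L[ℝ] Y) (iYX : Y →L[ℝ] X) (iXH : X →L[ℝ] H)
    (hiVY : Function.Injective iVY) (hiYX : Function.Injective iYX)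
    (hiXH : Function.Injective iXH)
    (F : V → ℝ) (F' : V → (V →L[ℝ] ℝ))
    (hF : ∀ v : V, HasFDerivAt F (F' v) v) (hF'cont : Continuous F')
    (g : ℝ → V → (V →L[ℝ] ℝ))
    (α β δ₁ δ₂ δ₃ D₄ : ℝ)
    (hα : 0 < α) (hαβ : α < β)
    (hδ₁ : 0 < δ₁) (hδ₂ : 0 < δ₂) (hδ₃ : 0 < δ₃) (hD₄ : 0 < D₄)
    -- (F2) with C₁ = 0
    (hF2 : ∀ v : V, F v ≥ δ₁ * ‖iVY v‖ ^ (β + 2))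
    -- (F3) with C₂ = 0
    (hF3 : ∀ v : V, F' v v ≥ δ₂ * F v)
    -- (G2) with C₃ = 0
    (hG2 : ∀ t ∈ Ioi (0:ℝ), ∀ v : V,
      g t v v ≥ δ₃ * ‖iYX (iVY v)‖ ^ (α + 2))
    -- (G3) with C₄ = 0
    (G : ℝ → V → (X →L[ℝ] ℝ))
    (hG3a : ∀ t ∈ Ioi (0:ℝ), ∀ v : V, g t v = (G t v).comp (iYX.comp iVY))
    (hG3b : ∀ t ∈ Ioi (0:ℝ), ∀ v : V,
      ‖G t v‖ ≤ D₄ * ‖iYX (iVY v)‖ ^ (α + 1)) :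
    ∃ D : ℝ,
      ∀ u u' : ℝ → V, ∀ w : ℝ → H,
        (∀ t ∈ Ioi (0:ℝ), HasDerivAt u (u' t) t) →
        (∀ t ∈ Ioi (0:ℝ), HasDerivAt (fun s => iXH (iYX (iVY (u' s)))) (w t) t) →
        (∀ t ∈ Ioi (0:ℝ), ∀ v : V,
          ⟪w t, iXH (iYX (iVY v))⟫ + F' (u t) v + g t (u' t) v = 0) →
        ∀ t ≥ (1:ℝ),
          ‖iXH (iYX (iVY (u' t)))‖ ^ 2 + F (u t)
            ≤ D * t ^ (-(1 / max (α / 2) ((β - α) / ((α + 1) * (β + 2))))) := by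
  have hβ2 : 0 < β + 2 := by linarith
  set cH := ‖iXH‖ * ‖iYX‖ with hcH
  set cY := (δ₁⁻¹) ^ (β + 2)⁻¹ with hcY
  have hcY0 : 0 ≤ cY := by positivity
  have hcH0 : 0 ≤ cH := by positivity
  obtain ⟨D, hD, hdecay⟩ := exists_universal_energy_decay (c₃ := 2 * cH * cY)
    (c₄ := D₄ * (‖iYX‖ * cY)) (c₅ := (1 + δ₂ / 2) * ‖iXH‖ ^ 2) hα hαβ hδ₂ hδ₃
    (by positivity) (by positivity) (by positivity)
  refine ⟨2 * D, ?_⟩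
  intro u u' w hu hw heq
  set i : V →L[ℝ] H := iXH.comp (iYX.comp iVY) with hi
  have hF0 : ∀ v, 0 ≤ F v := fun v => le_trans (by positivity) (hF2 v)
  have hH : ∀ v, ‖i v‖ ≤ ‖iXH‖ * ‖iYX (iVY v)‖ := fun v => iXH.le_opNorm _
  have hX : ∀ v, ‖iYX (iVY v)‖ ≤ ‖iYX‖ * ‖iVY v‖ := fun v => iYX.le_opNorm _
  have hw' : ∀ t ∈ Ioi (0 : ℝ), HasDerivAt (fun s => i (u' s)) (w t) t := hw
  have heq' : ∀ t ∈ Ioi (0 : ℝ), ∀ v : V, ⟪w t, i v⟫ + F' (u t) v + g t (u' t) v = 0 := heq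
  set E : ℝ → ℝ := fun t => 1 / 2 * ‖i (u' t)‖ ^ 2 + F (u t) with hEdef
  have hE0 : ∀ t, 0 ≤ E t := fun t => add_nonneg (by positivity) (hF0 _)
  have hYE : ∀ t, ‖iVY (u t)‖ ≤ cY * E t ^ (β + 2)⁻¹ := by
    intro t
    have h1 : ‖iVY (u t)‖ ^ (β + 2) ≤ δ₁⁻¹ * E t := by
      rw [le_inv_mul_iff₀ hδ₁]
      have h2 : F (u t) ≤ E t := le_add_of_nonneg_left (by positivity)
      exact (hF2 (u t)).le.trans h2
    have h3 := Real.rpow_le_rpow (by positivity) h1 (inv_nonneg.2 hβ2.le)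
    rwa [Real.rpow_rpow_inv (norm_nonneg _) hβ2.ne',
      Real.mul_rpow (by positivity) (hE0 t)] at h3
  have hHE : ∀ t, ‖i (u' t)‖ ≤ 2 * E t ^ (1 / 2 : ℝ) := by
    intro t
    rw [← Real.sqrt_eq_rpow]
    have h1 : ‖i (u' t)‖ ^ 2 ≤ 2 * E t := by
      have := hF0 (u t)
      simp only [hEdef]; linarith
    refine abs_le_of_sq_le_sq' ?_ (by positivity) |>.2
    rw [mul_pow, Real.sq_sqrt (hE0 t)]
    linarith [hE0 t]
  have hfinal := hdecay E (fun t => ‖iYX (iVY (u' t))‖) (fun t => g t (u' t) (u' t))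
    (fun t => ⟪i (u t), i (u' t)⟫) (fun t => ⟪i (u t), w t⟫ + ⟪i (u' t), i (u' t)⟫)
    ?_ ?_ (fun t _ => norm_nonneg _) (fun t ht => hG2 t ht _) ?_ ?_
  · intro t ht
    have h1 := hfinal t ht
    have h2 : ‖i (u' t)‖ ^ 2 + F (u t) ≤ 2 * E t := by
      have := hF0 (u t)
      simp only [hEdef]; linarith
    calc _ ≤ 2 * E t := h2
      _ ≤ _ := by linarith
  · intro t ht
    have h1 := ((hw' t ht).norm_sq.const_mul (1 / 2 : ℝ)).add
      ((hF (u t)).comp_hasDerivAt t (hu t ht))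
    refine h1.congr_deriv ?_
    have h2 := heq' t ht (u' t)
    rw [real_inner_comm] at h2
    linarith
  · intro t ht
    exact (i.hasFDerivAt.comp_hasDerivAt t (hu t ht)).inner ℝ (hw' t ht)
  · intro t ht
    have hu1 : ‖i (u t)‖ ≤ cH * ‖iVY (u t)‖ := by
      rw [hcH, mul_assoc]
      exact (hH _).trans (by gcongr; exact hX _)
    calc |⟪i (u t), i (u' t)⟫| ≤ ‖i (u t)‖ * ‖i (u' t)‖ := abs_real_inner_le_norm _ _
      _ ≤ (cH * (cY * E t ^ (β + 2)⁻¹)) * (2 * E t ^ (1 / 2 : ℝ)) := by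
        have hbd := hu1.trans (mul_le_mul_of_nonneg_left (hYE t) hcH0)
        exact mul_le_mul hbd (hHE t) (norm_nonneg _) ((norm_nonneg _).trans hbd)
      _ = 2 * cH * cY * (E t ^ (β + 2)⁻¹ * E t ^ (1 / 2 : ℝ)) := by ring
      _ = _ := by
        rw [← Real.rpow_add_of_nonneg (hE0 t) (by positivity) (by norm_num)]
  · intro t ht
    have h1 := heq' t ht (u t)
    rw [real_inner_comm] at h1
    have h2 := hF3 (u t)
    have h3 : -(g t (u' t) (u t)) ≤ D₄ * (‖iYX‖ * cY) * ‖iYX (iVY (u' t))‖ ^ (α + 1)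
        * E t ^ (β + 2)⁻¹ := by
      rw [hG3a t ht]
      calc -(G t (u' t) (iYX (iVY (u t)))) ≤ ‖G t (u' t) (iYX (iVY (u t)))‖ := neg_le_abs _
        _ ≤ ‖G t (u' t)‖ * ‖iYX (iVY (u t))‖ := (G t (u' t)).le_opNorm _
        _ ≤ (D₄ * ‖iYX (iVY (u' t))‖ ^ (α + 1)) * (‖iYX‖ * (cY * E t ^ (β + 2)⁻¹)) := by
          gcongr
          · exact hG3b t ht _
          · exact (hX _).trans (by gcongr; exact hYE t)
        _ = _ := by ring
    have h4 : ‖i (u' t)‖ ^ 2 ≤ ‖iXH‖ ^ 2 * ‖iYX (iVY (u' t))‖ ^ 2 := by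
      rw [← mul_pow]
      gcongr
      exact hH _
    have h5 : (1 + δ₂ / 2) * ‖i (u' t)‖ ^ 2
        ≤ (1 + δ₂ / 2) * (‖iXH‖ ^ 2 * ‖iYX (iVY (u' t))‖ ^ 2) := by gcongr
    have h6 : E t = 1 / 2 * ‖i (u' t)‖ ^ 2 + F (u t) := rfl
    have h7 : -δ₂ * E t = -(δ₂ / 2) * ‖i (u' t)‖ ^ 2 - δ₂ * F (u t) := by rw [h6]; ring
    rw [real_inner_self_eq_norm_sq, Real.rpow_two]
    linarith
end

section
/- Assume 0 < α < β, assume hypotheses (F2), (F3), (G2), (G3) hold with C₁ = C₂ = C₃ = C₄ = 0, and assume in addition: (norm interpolation) there exists C₅ > 0 with ‖v‖_X^{α+2} ≤ C₅(‖v‖_H² + ‖v‖_Y^{β+2}) for all v ∈ V, and (F4) there exists δ₄ > 0 with F(u) ≥ δ₄‖u‖_H² for all u ∈ V. Then there exists a real number D (depending only on α, β, the constants δ₁, δ₂, δ₃, δ₄, D₄, C₅ and the operator norms of the embedding maps, but not on the solution) such that for every classical solution u of u'' + ∇F(u) + g(t,u') = 0 on (0,∞) one has ‖i(u'(t))‖_H²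 + F(u(t)) ≤ D·t^{−2/α} for every t ≥ 1. -/
open Set RealInnerProductSpace

/-- Young's inequality with a small parameter. -/
theorem exists_young_const {p q η : ℝ} (hpq : p.HolderConjugate q) (hη : 0 < η) :
    ∃ C : ℝ, 0 < C ∧ ∀ a b : ℝ, 0 ≤ a → 0 ≤ b → a * b ≤ η * a ^ p + C * b ^ q := by
  have hl : 0 < η ^ (1 / p) := Real.rpow_pos_of_pos hη _
  refine ⟨((η ^ (1 / p))⁻¹) ^ q, by positivity, fun a b ha hb => ?_⟩
  have h := Real.young_inequality_of_nonneg (a := η ^ (1 / p) * a) (b := (η ^ (1 / p))⁻¹ * b)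
    (by positivity) (by positivity) hpq
  rw [Real.mul_rpow hl.le ha, Real.mul_rpow (by positivity) hb, ← Real.rpow_mul hη.le,
    one_div_mul_cancel hpq.ne_zero, Real.rpow_one] at h
  have h1 : η * a ^ p / p ≤ η * a ^ p := div_le_self (by positivity) hpq.lt.le
  have h2 : ((η ^ (1 / p))⁻¹) ^ q * b ^ q / q ≤ ((η ^ (1 / p))⁻¹) ^ q * b ^ q :=
    div_le_self (by positivity) hpq.symm.lt.le
  have h3 : η ^ (1 / p) * a * ((η ^ (1 / p))⁻¹ * b) = a * b := by field_simp
  linarith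

/-- A positive solution of `Φ' ≤ -c Φ^(1+s)` decays at a rate independent of its initial value. -/
theorem le_of_deriv_le_neg_rpow {s c a b : ℝ} {Φ Φ' : ℝ → ℝ} (hs : 0 < s) (hc : 0 < c)
    (hab : a < b) (hpos : ∀ t ∈ Icc a b, 0 < Φ t)
    (hder : ∀ t ∈ Icc a b, HasDerivAt Φ (Φ' t) t)
    (hle : ∀ t ∈ Icc a b, Φ' t ≤ -c * Φ t ^ (1 + s)) :
    Φ b ≤ (s * c * (b - a)) ^ (-(1 / s)) := by
  have hd : ∀ t ∈ Icc a b,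
      HasDerivAt (fun t => Φ t ^ (-s) - s * c * t) (Φ' t * (-s) * Φ t ^ (-s - 1) - s * c) t := by
    intro t ht
    have h1 := (hder t ht).rpow_const (p := -s) (Or.inl (hpos t ht).ne')
    exact (h1.sub ((hasDerivAt_id t).const_mul (s * c))).congr_deriv (by simp)
  have hmono : MonotoneOn (fun t => Φ t ^ (-s) - s * c * t) (Icc a b) := by
    refine monotoneOn_of_hasDerivWithinAt_nonneg (convex_Icc a b)
      (fun t ht => (hd t ht).continuousAt.continuousWithinAt)
      (fun t ht => (hd t (interior_subset ht)).hasDerivWithinAt) ?_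
    intro t ht
    have ht' := interior_subset ht
    have hP := hpos t ht'
    have h1 : Φ t ^ (1 + s) * Φ t ^ (-s - 1) = 1 := by
      rw [← Real.rpow_add hP, show 1 + s + (-s - 1) = 0 by ring, Real.rpow_zero]
    have h2 := mul_le_mul_of_nonneg_right (hle t ht') (Real.rpow_nonneg hP.le (-s - 1))
    rw [mul_assoc, h1] at h2
    nlinarith
  have hm := hmono (left_mem_Icc.2 hab.le) (right_mem_Icc.2 hab.le) hab.le
  have ha := Real.rpow_pos_of_pos (hpos a (left_mem_Icc.2 hab.le)) (-s)
  have hb := hpos b (right_mem_Icc.2 hab.le)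
  have hkey : s * c * (b - a) ≤ Φ b ^ (-s) := by linarith
  have h0 : 0 < s * c * (b - a) := by have := sub_pos.2 hab; positivity
  have h := Real.rpow_le_rpow_of_nonpos h0 hkey (z := -(1 / s)) (by
    have : 0 < 1 / s := by positivity
    linarith)
  rwa [← Real.rpow_mul hb.le, neg_mul_neg, mul_one_div_cancel hs.ne', Real.rpow_one] at h

/-- Decay of an energy `E`, by differentiating the perturbed energy `E + ε E^s p`. -/
theorem exists_energy_decay_const {α δ₂ δ₃ D₄ B s K : ℝ} (hα : 0 < α) (hδ₂ : 0 < δ₂)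
    (hδ₃ : 0 < δ₃) (hD₄ : 0 < D₄) (hB : 0 < B) (hs : 0 < s) (hK : 0 < K) :
    ∃ C : ℝ, 0 < C ∧ ∀ (E p d q v x : ℝ → ℝ) (a b : ℝ), a < b →
      (∀ t ∈ Icc a b, 0 < E t) →
      (∀ t ∈ Icc a b, HasDerivAt E (-d t) t) →
      (∀ t ∈ Icc a b, HasDerivAt p (q t) t) →
      (∀ t ∈ Icc a b, 0 ≤ v t) →
      (∀ t ∈ Icc a b, 0 ≤ x t) →
      (∀ t ∈ Icc a b, δ₃ * v t ^ (α + 2) ≤ d t) →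
      (∀ t ∈ Icc a b, q t ≤ B * v t ^ 2 - δ₂ * E t + D₄ * v t ^ (α + 1) * x t) →
      (∀ t ∈ Icc a b, E t ^ s * |p t| ≤ K * E t) →
      (∀ t ∈ Icc a b, E t ^ (2 * s / α) ≤ K * E t) →
      (∀ t ∈ Icc a b, E t ^ (s * (α + 1)) * x t ^ (α + 2) ≤ K * E t) →
      E b ≤ C * (b - a) ^ (-(1 / s)) := by
  have hpq₁ : ((α + 2) / α).HolderConjugate ((α + 2) / 2) := by
    rw [Real.holderConjugate_iff]
    exact ⟨by rw [lt_div_iff₀ hα]; linarith, by field_simp⟩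
  have hpq₂ : (α + 2).HolderConjugate ((α + 2) / (α + 1)) := by
    rw [Real.holderConjugate_iff]
    exact ⟨by linarith, by field_simp; ring⟩
  obtain ⟨C₁, hC₁, hY₁⟩ := exists_young_const (η := δ₂ / (4 * B * K)) hpq₁ (by positivity)
  obtain ⟨C₂, hC₂, hY₂⟩ := exists_young_const (η := δ₂ / (4 * D₄ * K)) hpq₂ (by positivity)
  set K₂ := B * C₁ + D₄ * C₂ with hK₂
  have hK₂pos : 0 < K₂ := by positivity
  obtain ⟨ε, hε, hε₁, hε₂, hε₃⟩ : ∃ ε : ℝ, 0 < ε ∧ ε * (s * K) ≤ 1 / 2 ∧ ε * K₂ ≤ δ₃ / 2 ∧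
      ε * K ≤ 1 / 2 := by
    refine ⟨min (1 / 2 / (s * K)) (min (δ₃ / 2 / K₂) (1 / 2 / K)), by positivity, ?_, ?_, ?_⟩
    · rw [← le_div_iff₀ (by positivity)]; exact min_le_left _ _
    · rw [← le_div_iff₀ (by positivity)]; exact (min_le_right _ _).trans (min_le_left _ _)
    · rw [← le_div_iff₀ (by positivity)]; exact (min_le_right _ _).trans (min_le_right _ _)
  set c := ε * (δ₂ / 2) * (2 / 3) ^ (1 + s) with hc
  have hcpos : 0 < c := by positivity
  refine ⟨2 * (s * c) ^ (-(1 / s)), by positivity, ?_⟩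
  intro E p d q v x a b hab hE hEd hpd hv hx hd hq h1 h2 h3
  have hPhi : ∀ t ∈ Icc a b, |ε * (E t ^ s * p t)| ≤ E t / 2 := by
    intro t ht
    rw [abs_mul, abs_mul, abs_of_pos hε, abs_of_pos (Real.rpow_pos_of_pos (hE t ht) s)]
    nlinarith [h1 t ht, hE t ht]
  have hder : ∀ t ∈ Icc a b, HasDerivAt (fun t => E t + ε * (E t ^ s * p t))
      (-d t + ε * ((-d t * s * E t ^ (s - 1)) * p t + E t ^ s * q t)) t := fun t ht =>
    (hEd t ht).add ((((hEd t ht).rpow_const (Or.inl (hE t ht).ne')).mul (hpd t ht)).const_mul ε)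
  have hmain := le_of_deriv_le_neg_rpow hs hcpos hab
    (fun t ht => by have := abs_le.1 (hPhi t ht); have := hE t ht; linarith) hder ?_
  · have hb := right_mem_Icc.2 hab.le
    have := abs_le.1 (hPhi b hb)
    rw [Real.mul_rpow (by positivity) (sub_pos.2 hab).le] at hmain
    linarith
  · intro t ht
    have hEt := hE t ht
    have hvt := hv t ht
    have hxt := hx t ht
    have hEs : 0 < E t ^ s := Real.rpow_pos_of_pos hEt s
    have hvp : 0 ≤ v t ^ (α + 2) := Real.rpow_nonneg hvt _
    have hdt : 0 ≤ d t := (mul_nonneg hδ₃.le hvp).trans (hd t ht)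
    have hEs1 : E t ^ (1 + s) = E t * E t ^ s := by rw [Real.rpow_add hEt, Real.rpow_one]
    have hy₁ := hY₁ (E t ^ s) (v t ^ 2) hEs.le (by positivity)
    have hy₂ := hY₂ (E t ^ s * x t) (v t ^ (α + 1)) (by positivity) (by positivity)
    have e1 : (v t ^ 2) ^ ((α + 2) / 2) = v t ^ (α + 2) := by
      rw [← Real.rpow_natCast, ← Real.rpow_mul hvt]; congr 1; push_cast; ring
    have e2 : (v t ^ (α + 1)) ^ ((α + 2) / (α + 1)) = v t ^ (α + 2) := by
      rw [← Real.rpow_mul hvt]; congr 1; field_simp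
    have e3 : (E t ^ s) ^ ((α + 2) / α) = E t ^ s * E t ^ (2 * s / α) := by
      rw [← Real.rpow_mul hEt.le, ← Real.rpow_add hEt]; congr 1; field_simp
    have e4 : (E t ^ s * x t) ^ (α + 2)
        = E t ^ s * (E t ^ (s * (α + 1)) * x t ^ (α + 2)) := by
      rw [Real.mul_rpow hEs.le hxt, ← Real.rpow_mul hEt.le, ← mul_assoc, ← Real.rpow_add hEt]
      congr 2; ring
    rw [e1, e3] at hy₁
    rw [e2, e4] at hy₂
    have hz₁ : B * (E t ^ s * v t ^ 2)
        ≤ δ₂ / 4 * (E t * E t ^ s) + B * C₁ * v t ^ (α + 2) := by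
      have i1 := mul_le_mul_of_nonneg_left (h2 t ht) hEs.le
      have i2 := mul_le_mul_of_nonneg_left i1 (by positivity : 0 ≤ δ₂ / (4 * B * K))
      have i3 := mul_le_mul_of_nonneg_left (hy₁.trans (add_le_add_left i2 _)) hB.le
      refine i3.trans (le_of_eq ?_)
      field_simp
    have hz₂ : D₄ * (E t ^ s * x t * v t ^ (α + 1))
        ≤ δ₂ / 4 * (E t * E t ^ s) + D₄ * C₂ * v t ^ (α + 2) := by
      have i1 := mul_le_mul_of_nonneg_left (h3 t ht) hEs.le
      have i2 := mul_le_mul_of_nonneg_left i1 (by positivity : 0 ≤ δ₂ / (4 * D₄ * K))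
      have i3 := mul_le_mul_of_nonneg_left (hy₂.trans (add_le_add_left i2 _)) hD₄.le
      refine i3.trans (le_of_eq ?_)
      field_simp
    have hq' : E t ^ s * q t ≤ K₂ * v t ^ (α + 2) - δ₂ / 2 * (E t * E t ^ s) := by
      have := mul_le_mul_of_nonneg_left (hq t ht) hEs.le
      rw [hK₂]; linarith
    have hp' : (-d t * s * E t ^ (s - 1)) * p t ≤ s * K * d t := by
      have i0 : E t ^ (s - 1) * |p t| ≤ K := by
        rw [Real.rpow_sub_one hEt.ne', div_mul_eq_mul_div, div_le_iff₀ hEt]; exact h1 t ht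
      have i1 : -(E t ^ (s - 1) * p t) ≤ K := by
        refine le_trans ?_ i0
        rw [← mul_neg]
        exact mul_le_mul_of_nonneg_left (neg_le_abs _) (Real.rpow_nonneg hEt.le _)
      have := mul_le_mul_of_nonneg_left i1 (mul_nonneg hs.le hdt)
      linarith
    have hΦ' : -d t + ε * ((-d t * s * E t ^ (s - 1)) * p t + E t ^ s * q t)
        ≤ -(ε * (δ₂ / 2)) * (E t * E t ^ s) := by
      have i1 := mul_le_mul_of_nonneg_left (add_le_add hp' hq') hε.le
      have i2 := mul_le_mul_of_nonneg_right hε₁ hdt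
      have i3 := mul_le_mul_of_nonneg_right hε₂ hvp
      have i4 := hd t ht
      linarith
    refine hΦ'.trans ?_
    have habs := abs_le.1 (hPhi t ht)
    have hpow : (2 / 3) ^ (1 + s) * (E t + ε * (E t ^ s * p t)) ^ (1 + s) ≤ E t * E t ^ s := by
      rw [← hEs1, ← Real.mul_rpow (by norm_num) (by linarith)]
      exact Real.rpow_le_rpow (by linarith) (by linarith) (by linarith)
    have := mul_le_mul_of_nonneg_left hpow (by positivity : 0 ≤ ε * (δ₂ / 2))
    rw [hc]; linarith

set_option maxHeartbeats 1000000 in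
/-- Universal decay under stronger assumptions (Theorem 3.4 of the paper): under
assumptions (F2)-(F3)-(G2)-(G3) with `C₁ = C₂ = C₃ = C₄ = 0`, the norm interpolation
inequality `‖v‖_X^{α+2} ≤ C₅(‖v‖_H² + ‖v‖_Y^{β+2})`, and (F4) `F(u) ≥ δ₄‖u‖_H²`, in the
regime `0 < α < β`, there exists a constant `D`, independent of the solution, such that
every classical solution of `u'' + ∇F(u) + g(t,u') = 0` on `(0,∞)` satisfies
`‖u'(t)‖_H² + F(u(t)) ≤ D t^{-2/α}` for all `t ≥ 1`. -/
theorem stmt_4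
    (V H X Y : Type*)
    [NormedAddCommGroup V] [InnerProductSpace ℝ V]
    [NormedAddCommGroup H] [InnerProductSpace ℝ H]
    [NormedAddCommGroup X] [NormedSpace ℝ X]
    [NormedAddCommGroup Y] [NormedSpace ℝ Y]
    -- chain of continuous embeddings V ⊆ Y ⊆ X ⊆ H
    (iVY : V →L[ℝ] Y) (iYX : Y →L[ℝ] X) (iXH : X →L[ℝ] H)
    (hiVY : Function.Injective iVY) (hiYX : Function.Injective iYX)
    (hiXH : Function.Injective iXH)
    (F : V → ℝ) (F' : V → (V →L[ℝ] ℝ))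
    (hF : ∀ v : V, HasFDerivAt F (F' v) v) (hF'cont : Continuous F')
    (g : ℝ → V → (V →L[ℝ] ℝ))
    (α β δ₁ δ₂ δ₃ δ₄ D₄ C₅ : ℝ)
    (hα : 0 < α) (hαβ : α < β)
    (hδ₁ : 0 < δ₁) (hδ₂ : 0 < δ₂) (hδ₃ : 0 < δ₃) (hδ₄ : 0 < δ₄)
    (hD₄ : 0 < D₄) (hC₅ : 0 < C₅)
    -- (F2) with C₁ = 0
    (hF2 : ∀ v : V, F v ≥ δ₁ * ‖iVY v‖ ^ (β + 2))
    -- (F3) with C₂ = 0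
    (hF3 : ∀ v : V, F' v v ≥ δ₂ * F v)
    -- (F4)
    (hF4 : ∀ v : V, F v ≥ δ₄ * ‖iXH (iYX (iVY v))‖ ^ 2)
    -- norm interpolation
    (hnorms : ∀ v : V,
      ‖iYX (iVY v)‖ ^ (α + 2)
        ≤ C₅ * (‖iXH (iYX (iVY v))‖ ^ 2 + ‖iVY v‖ ^ (β + 2)))
    -- (G2) with C₃ = 0
    (hG2 : ∀ t ∈ Ioi (0:ℝ), ∀ v : V,
      g t v v ≥ δ₃ * ‖iYX (iVY v)‖ ^ (α + 2))
    -- (G3) with C₄ = 0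
    (G : ℝ → V → (X →L[ℝ] ℝ))
    (hG3a : ∀ t ∈ Ioi (0:ℝ), ∀ v : V, g t v = (G t v).comp (iYX.comp iVY))
    (hG3b : ∀ t ∈ Ioi (0:ℝ), ∀ v : V,
      ‖G t v‖ ≤ D₄ * ‖iYX (iVY v)‖ ^ (α + 1)) :
    ∃ D : ℝ,
      ∀ u u' : ℝ → V, ∀ w : ℝ → H,
        (∀ t ∈ Ioi (0:ℝ), HasDerivAt u (u' t) t) →
        (∀ t ∈ Ioi (0:ℝ), HasDerivAt (fun s => iXH (iYX (iVY (u' s)))) (w t) t) →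
        (∀ t ∈ Ioi (0:ℝ), ∀ v : V,
          ⟪w t, iXH (iYX (iVY v))⟫ + F' (u t) v + g t (u' t) v = 0) →
        ∀ t ≥ (1:ℝ),
          ‖iXH (iYX (iVY (u' t)))‖ ^ 2 + F (u t) ≤ D * t ^ (-(2 / α)) := by
  have hc : ∀ v : V, ‖iXH (iYX (iVY v))‖ ≤ ‖iXH‖ * ‖iYX‖ * ‖iVY v‖ := fun v =>
    (iXH.le_opNorm _).trans (by
      rw [mul_assoc]
      exact mul_le_mul_of_nonneg_left (iYX.le_opNorm _) (norm_nonneg _))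
  set B : ℝ := (1 + δ₂ / 2) * ‖iXH‖ ^ 2 + 1 with hB
  have hBpos : 0 < B := by positivity
  have hβ : 0 < β := hα.trans hαβ
  obtain ⟨σ, hσ, hσ₁, hσ₂, hσ₃⟩ : ∃ σ : ℝ, 0 < σ ∧ σ + (1 / (β + 2) + 1 / 2) ≤ 1 ∧
      2 * σ / α ≤ 1 ∧ σ * (α + 1) + 1 / (β + 2) * (α + 2) ≤ 1 := by
    have h0 : 1 / (β + 2) + 1 / 2 < 1 := by
      have : 1 / (β + 2) < 1 / 2 := one_div_lt_one_div_of_lt (by norm_num) (by linarith)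
      linarith
    have h1 : 1 / (β + 2) * (α + 2) < 1 := by
      rw [one_div_mul_eq_div, div_lt_one (by linarith)]; linarith
    refine ⟨min (1 - (1 / (β + 2) + 1 / 2))
      (min (α / 2) ((1 - 1 / (β + 2) * (α + 2)) / (α + 1))), ?_, ?_, ?_, ?_⟩
    · exact lt_min (by linarith)
        (lt_min (by positivity) (div_pos (by linarith) (by linarith)))
    · linarith [min_le_left (1 - (1 / (β + 2) + 1 / 2))
        (min (α / 2) ((1 - 1 / (β + 2) * (α + 2)) / (α + 1)))]
    · rw [div_le_one hα]
      linarith [(min_le_right (1 - (1 / (β + 2) + 1 / 2))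
        (min (α / 2) ((1 - 1 / (β + 2) * (α + 2)) / (α + 1)))).trans (min_le_left _ _)]
    · have := (min_le_right (1 - (1 / (β + 2) + 1 / 2))
        (min (α / 2) ((1 - 1 / (β + 2) * (α + 2)) / (α + 1)))).trans (min_le_right _ _)
      rw [le_div_iff₀ (by linarith)] at this
      linarith
  set L : ℝ := (1 / δ₁) ^ (1 / (β + 2)) with hL
  have hLpos : 0 < L := by positivity
  set K₁ : ℝ := ‖iXH‖ * ‖iYX‖ * L * 2 + 1 + (‖iYX‖ * L) ^ (α + 2) with hK₁
  have hK₁pos : 0 < K₁ := by positivity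
  obtain ⟨A₁, hA₁, hdecay₁⟩ :=
    exists_energy_decay_const hα hδ₂ hδ₃ hD₄ hBpos hσ hK₁pos
  set M : ℝ := max 1 (A₁ * (1 / 2 - 1 / 4) ^ (-(1 / σ))) with hM
  have hMpos : 0 < M := lt_max_of_lt_left one_pos
  set K₂ : ℝ := M ^ (α / 2) * (1 / (2 * δ₄) + 1) + 1
    + M ^ (α / 2 * (α + 1)) * (C₅ * (1 / δ₄ + 1 / δ₁)) with hK₂
  have hK₂pos : 0 < K₂ := by positivity
  obtain ⟨A₂, hA₂, hdecay₂⟩ :=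
    exists_energy_decay_const hα hδ₂ hδ₃ hD₄ hBpos (half_pos hα) hK₂pos
  refine ⟨2 * (A₂ * (1 / 2) ^ (-(2 / α))), ?_⟩
  intro u u' w hu hu' heq
  set E : ℝ → ℝ := fun t => 1 / 2 * ‖iXH (iYX (iVY (u' t)))‖ ^ 2 + F (u t) with hE
  set p : ℝ → ℝ := fun t => ⟪iXH (iYX (iVY (u t))), iXH (iYX (iVY (u' t)))⟫ with hp
  set d : ℝ → ℝ := fun t => g t (u' t) (u' t) with hd
  set q : ℝ → ℝ := fun t =>
    ⟪iXH (iYX (iVY (u t))), w t⟫ + ⟪iXH (iYX (iVY (u' t))), iXH (iYX (iVY (u' t)))⟫ with hq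
  have hF0 : ∀ v, 0 ≤ F v := fun v => le_trans (by positivity) (hF2 v)
  have hEnn : ∀ t, 0 ≤ E t := fun t => add_nonneg (by positivity) (hF0 _)
  have hFE : ∀ t, F (u t) ≤ E t := fun t => le_add_of_nonneg_left (by positivity)
  have hUE : ∀ t, ‖iXH (iYX (iVY (u' t)))‖ ^ 2 ≤ 2 * E t := fun t => by
    simp only [hE]; linarith [hF0 (u t)]
  have hEd : ∀ t ∈ Ioi (0 : ℝ), HasDerivAt E (-d t) t := by
    intro t ht
    have h1 := (hu' t ht).norm_sq.const_mul (1 / 2 : ℝ)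
    have h2 := (hF (u t)).comp_hasDerivAt t (hu t ht)
    refine (h1.add h2).congr_deriv ?_
    have := heq t ht (u' t)
    rw [real_inner_comm]
    simp only [hd]; linarith
  have hpd : ∀ t ∈ Ioi (0 : ℝ), HasDerivAt p (q t) t := by
    intro t ht
    have h1 : HasDerivAt (fun s => iXH (iYX (iVY (u s)))) (iXH (iYX (iVY (u' t)))) t :=
      ((iXH.comp (iYX.comp iVY)).hasFDerivAt).comp_hasDerivAt t (hu t ht)
    exact h1.inner ℝ (hu' t ht)
  have hdv : ∀ t ∈ Ioi (0 : ℝ), δ₃ * ‖iYX (iVY (u' t))‖ ^ (α + 2) ≤ d t :=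
    fun t ht => hG2 t ht (u' t)
  have hqv : ∀ t ∈ Ioi (0 : ℝ), q t ≤ B * ‖iYX (iVY (u' t))‖ ^ 2 - δ₂ * E t
      + D₄ * ‖iYX (iVY (u' t))‖ ^ (α + 1) * ‖iYX (iVY (u t))‖ := by
    intro t ht
    have h1 := heq t ht (u t)
    have h2 : -(g t (u' t) (u t))
        ≤ D₄ * ‖iYX (iVY (u' t))‖ ^ (α + 1) * ‖iYX (iVY (u t))‖ := by
      rw [hG3a t ht]
      refine (neg_le_abs _).trans (((G t (u' t)).le_opNorm _).trans ?_)
      exact mul_le_mul_of_nonneg_right (hG3b t ht _) (norm_nonneg _)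
    have h3 := hF3 (u t)
    have h4 : ‖iXH (iYX (iVY (u' t)))‖ ^ 2 ≤ ‖iXH‖ ^ 2 * ‖iYX (iVY (u' t))‖ ^ 2 := by
      rw [← mul_pow]
      exact pow_le_pow_left₀ (norm_nonneg _) (iXH.le_opNorm _) 2
    have h5 := mul_le_mul_of_nonneg_left h4 (by positivity : 0 ≤ 1 + δ₂ / 2)
    have h6 : 0 ≤ ‖iYX (iVY (u' t))‖ ^ 2 := by positivity
    simp only [hq, hE, hB]
    rw [real_inner_self_eq_norm_sq, real_inner_comm]
    linarith
  have hanti : AntitoneOn E (Ioi 0) := by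
    refine antitoneOn_of_hasDerivWithinAt_nonpos (convex_Ioi 0)
      (fun t ht => (hEd t ht).continuousAt.continuousWithinAt)
      (fun t ht => (hEd t (interior_subset ht)).hasDerivWithinAt) ?_
    intro t ht
    have := hdv t (interior_subset ht)
    have : 0 ≤ δ₃ * ‖iYX (iVY (u' t))‖ ^ (α + 2) := by positivity
    linarith
  have hpabs : ∀ t, |p t| ≤ ‖iXH (iYX (iVY (u t)))‖ * ‖iXH (iYX (iVY (u' t)))‖ :=
    fun t => abs_real_inner_le_norm _ _
  have hEhalf : E (1 / 2) ≤ M := by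
    rcases le_or_gt (E (1 / 2)) 1 with h | h
    · exact h.trans (le_max_left _ _)
    refine le_trans ?_ (le_max_right _ _)
    have hsub : ∀ t ∈ Icc (1 / 4 : ℝ) (1 / 2), t ∈ Ioi (0 : ℝ) := fun t ht =>
      lt_of_lt_of_le (by norm_num) ht.1
    have hE1 : ∀ t ∈ Icc (1 / 4 : ℝ) (1 / 2), 1 ≤ E t := fun t ht =>
      h.le.trans (hanti (hsub t ht) (by norm_num) ht.2)
    have hpow : ∀ t ∈ Icc (1 / 4 : ℝ) (1 / 2), ∀ r ≤ (1 : ℝ), E t ^ r ≤ E t := fun t ht r hr =>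
      (Real.rpow_le_rpow_of_exponent_le (hE1 t ht) hr).trans_eq (Real.rpow_one _)
    have hy : ∀ t, ‖iVY (u t)‖ ≤ L * E t ^ (1 / (β + 2)) := by
      intro t
      have h1 : ‖iVY (u t)‖ ^ (β + 2) ≤ 1 / δ₁ * E t := by
        rw [one_div_mul_eq_div, le_div_iff₀ hδ₁]
        linarith [hF2 (u t), hFE t]
      have h2 := Real.rpow_le_rpow (by positivity) h1
        (by positivity : 0 ≤ 1 / (β + 2))
      rwa [← Real.rpow_mul (norm_nonneg _), mul_one_div_cancel (by linarith), Real.rpow_one,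
        Real.mul_rpow (by positivity) (hEnn t)] at h2
    refine hdecay₁ E p d q (fun t => ‖iYX (iVY (u' t))‖) (fun t => ‖iYX (iVY (u t))‖)
      (1 / 4) (1 / 2) (by norm_num) (fun t ht => one_pos.trans_le (hE1 t ht))
      (fun t ht => hEd t (hsub t ht)) (fun t ht => hpd t (hsub t ht))
      (fun t _ => norm_nonneg _) (fun t _ => norm_nonneg _)
      (fun t ht => hdv t (hsub t ht)) (fun t ht => hqv t (hsub t ht)) ?_ ?_ ?_
    · intro t ht
      have hEt : 0 < E t := one_pos.trans_le (hE1 t ht)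
      have hU : ‖iXH (iYX (iVY (u' t)))‖ ≤ 2 * E t ^ (1 / 2 : ℝ) := by
        refine (abs_le_of_sq_le_sq' ?_ (by positivity)).2
        rw [mul_pow, ← Real.sqrt_eq_rpow, Real.sq_sqrt hEt.le]
        linarith [hUE t]
      have hu0 : ‖iXH (iYX (iVY (u t)))‖ ≤ ‖iXH‖ * ‖iYX‖ * (L * E t ^ (1 / (β + 2))) :=
        (hc _).trans (mul_le_mul_of_nonneg_left (hy t) (by positivity))
      calc E t ^ σ * |p t|
          ≤ E t ^ σ * ((‖iXH‖ * ‖iYX‖ * (L * E t ^ (1 / (β + 2)))) * (2 * E t ^ (1 / 2 : ℝ))) :=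
            mul_le_mul_of_nonneg_left ((hpabs t).trans
              (mul_le_mul hu0 hU (norm_nonneg _) (by positivity))) (by positivity)
        _ = ‖iXH‖ * ‖iYX‖ * L * 2 * E t ^ (σ + (1 / (β + 2) + 1 / 2)) := by
            rw [Real.rpow_add hEt, Real.rpow_add hEt]; ring
        _ ≤ ‖iXH‖ * ‖iYX‖ * L * 2 * E t :=
            mul_le_mul_of_nonneg_left (hpow t ht _ hσ₁) (by positivity)
        _ ≤ K₁ * E t := mul_le_mul_of_nonneg_right (by
            have : 0 ≤ (‖iYX‖ * L) ^ (α + 2) := by positivity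
            rw [hK₁]; linarith) hEt.le
    · intro t ht
      refine (hpow t ht _ hσ₂).trans (le_mul_of_one_le_left (hEnn t) ?_)
      have : 0 ≤ (‖iYX‖ * L) ^ (α + 2) := by positivity
      have : 0 ≤ ‖iXH‖ * ‖iYX‖ * L * 2 := by positivity
      rw [hK₁]; linarith
    · intro t ht
      have hEt : 0 < E t := one_pos.trans_le (hE1 t ht)
      have hx : ‖iYX (iVY (u t))‖ ≤ ‖iYX‖ * L * E t ^ (1 / (β + 2)) := by
        rw [mul_assoc]
        exact (iYX.le_opNorm _).trans (mul_le_mul_of_nonneg_left (hy t) (norm_nonneg _))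
      calc E t ^ (σ * (α + 1)) * ‖iYX (iVY (u t))‖ ^ (α + 2)
          ≤ E t ^ (σ * (α + 1)) * (‖iYX‖ * L * E t ^ (1 / (β + 2))) ^ (α + 2) :=
            mul_le_mul_of_nonneg_left
              (Real.rpow_le_rpow (norm_nonneg _) hx (by linarith)) (by positivity)
        _ = (‖iYX‖ * L) ^ (α + 2) * E t ^ (σ * (α + 1) + 1 / (β + 2) * (α + 2)) := by
            rw [Real.rpow_add hEt, Real.mul_rpow (by positivity) (by positivity),
              Real.rpow_mul hEt.le (1 / (β + 2))]
            ring
        _ ≤ (‖iYX‖ * L) ^ (α + 2) * E t :=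
            mul_le_mul_of_nonneg_left (hpow t ht _ hσ₃) (by positivity)
        _ ≤ K₁ * E t := mul_le_mul_of_nonneg_right (by
            have : 0 ≤ ‖iXH‖ * ‖iYX‖ * L * 2 := by positivity
            rw [hK₁]; linarith) hEt.le
  intro T hT
  have hT0 : (0 : ℝ) < T := one_pos.trans_le hT
  have hgoal : E T ≤ A₂ * (1 / 2) ^ (-(2 / α)) * T ^ (-(2 / α)) := by
    rcases (hEnn T).eq_or_lt with h | h
    · rw [← h]; positivity
    have hsub : ∀ t ∈ Icc (1 / 2 : ℝ) T, t ∈ Ioi (0 : ℝ) := fun t ht =>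
      lt_of_lt_of_le (by norm_num) ht.1
    have hEpos : ∀ t ∈ Icc (1 / 2 : ℝ) T, 0 < E t := fun t ht =>
      h.trans_le (hanti (hsub t ht) hT0 ht.2)
    have hEM : ∀ t ∈ Icc (1 / 2 : ℝ) T, E t ≤ M := fun t ht =>
      (hanti (by norm_num) (hsub t ht) ht.1).trans hEhalf
    have huE : ∀ t, ‖iXH (iYX (iVY (u t)))‖ ^ 2 ≤ 1 / δ₄ * E t := by
      intro t
      rw [one_div_mul_eq_div, le_div_iff₀ hδ₄]
      linarith [hF4 (u t), hFE t]
    have key := hdecay₂ E p d q (fun t => ‖iYX (iVY (u' t))‖) (fun t => ‖iYX (iVY (u t))‖)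
      (1 / 2) T (by linarith) hEpos
      (fun t ht => hEd t (hsub t ht)) (fun t ht => hpd t (hsub t ht))
      (fun t _ => norm_nonneg _) (fun t _ => norm_nonneg _)
      (fun t ht => hdv t (hsub t ht)) (fun t ht => hqv t (hsub t ht)) ?_ ?_ ?_
    · rw [one_div_div] at key
      refine key.trans ?_
      rw [mul_assoc, ← Real.mul_rpow (by norm_num) hT0.le]
      refine mul_le_mul_of_nonneg_left ?_ hA₂.le
      refine Real.rpow_le_rpow_of_nonpos (by positivity) (by linarith) ?_
      have : 0 < 2 / α := by positivity
      linarith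
    · intro t ht
      have h1 : |p t| ≤ (1 / (2 * δ₄) + 1) * E t := by
        have e : (1 / (2 * δ₄) + 1) * E t = (1 / δ₄ * E t + 2 * E t) / 2 := by
          field_simp
        rw [e]
        nlinarith [hpabs t, huE t, hUE t,
          sq_nonneg (‖iXH (iYX (iVY (u t)))‖ - ‖iXH (iYX (iVY (u' t)))‖)]
      have h2 : E t ^ (α / 2) ≤ M ^ (α / 2) :=
        Real.rpow_le_rpow (hEnn t) (hEM t ht) (by positivity)
      calc E t ^ (α / 2) * |p t|
          ≤ M ^ (α / 2) * ((1 / (2 * δ₄) + 1) * E t) :=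
            mul_le_mul h2 h1 (abs_nonneg _) (by positivity)
        _ = M ^ (α / 2) * (1 / (2 * δ₄) + 1) * E t := by ring
        _ ≤ K₂ * E t := mul_le_mul_of_nonneg_right (by
            have : 0 ≤ M ^ (α / 2 * (α + 1)) * (C₅ * (1 / δ₄ + 1 / δ₁)) := by positivity
            rw [hK₂]; linarith) (hEnn t)
    · intro t ht
      have e : 2 * (α / 2) / α = 1 := by field_simp
      rw [e, Real.rpow_one]
      refine le_mul_of_one_le_left (hEnn t) ?_
      have : 0 ≤ M ^ (α / 2) * (1 / (2 * δ₄) + 1) := by positivity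
      have : 0 ≤ M ^ (α / 2 * (α + 1)) * (C₅ * (1 / δ₄ + 1 / δ₁)) := by positivity
      rw [hK₂]; linarith
    · intro t ht
      have h1 : ‖iYX (iVY (u t))‖ ^ (α + 2) ≤ C₅ * (1 / δ₄ + 1 / δ₁) * E t := by
        have h0 : ‖iVY (u t)‖ ^ (β + 2) ≤ 1 / δ₁ * E t := by
          rw [one_div_mul_eq_div, le_div_iff₀ hδ₁]
          linarith [hF2 (u t), hFE t]
        refine (hnorms (u t)).trans ?_
        rw [mul_assoc]
        refine mul_le_mul_of_nonneg_left ?_ hC₅.le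
        linarith [huE t]
      have h2 : E t ^ (α / 2 * (α + 1)) ≤ M ^ (α / 2 * (α + 1)) :=
        Real.rpow_le_rpow (hEnn t) (hEM t ht) (by positivity)
      calc E t ^ (α / 2 * (α + 1)) * ‖iYX (iVY (u t))‖ ^ (α + 2)
          ≤ M ^ (α / 2 * (α + 1)) * (C₅ * (1 / δ₄ + 1 / δ₁) * E t) :=
            mul_le_mul h2 h1 (by positivity) (by positivity)
        _ = M ^ (α / 2 * (α + 1)) * (C₅ * (1 / δ₄ + 1 / δ₁)) * E t := by ring
        _ ≤ K₂ * E t := mul_le_mul_of_nonneg_right (by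
            have : 0 ≤ M ^ (α / 2) * (1 / (2 * δ₄) + 1) := by positivity
            rw [hK₂]; linarith) (hEnn t)
  have : ‖iXH (iYX (iVY (u' T)))‖ ^ 2 + F (u T) ≤ 2 * E T := by
    simp only [hE]; linarith [hF0 (u T)]
  linarith
end

section
/- Let δ and ρ be positive real numbers, and let u : (0,∞) → ℝ be a differentiable function satisfying u'(t) + δ|u(t)|^{ρ}u(t) = 0 for every t > 0. Then |u(t)| ≤ (ρδ)^{−1/ρ}·t^{−1/ρ} for every t > 0, independently of any initial condition. -/
/-- Along a solution, `u ^ 2` satisfies an autonomous equation. -/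
theorem hasDerivAt_sq_of_ode {δ ρ : ℝ} {u : ℝ → ℝ} {t : ℝ}
    (hdiff : DifferentiableAt ℝ u t) (hode : deriv u t + δ * |u t| ^ ρ * u t = 0) :
    HasDerivAt (fun s => u s ^ 2) (-(2 * δ * |u t| ^ ρ * u t ^ 2)) t := by
  have h := hdiff.hasDerivAt.pow 2
  have e : deriv u t = -(δ * |u t| ^ ρ * u t) := by linarith
  rw [e] at h
  refine h.congr_deriv ?_
  push_cast
  ring

/-- Solutions have nonincreasing square on the positive half-line. -/
theorem antitoneOn_sq_of_ode {δ ρ : ℝ} (hδ : 0 < δ) {u : ℝ → ℝ}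
    (hdiff : ∀ t > (0:ℝ), DifferentiableAt ℝ u t)
    (hode : ∀ t > (0:ℝ), deriv u t + δ * |u t| ^ ρ * u t = 0) :
    AntitoneOn (fun s => u s ^ 2) (Set.Ioi 0) := by
  have hd : ∀ t > (0:ℝ), HasDerivAt (fun s => u s ^ 2) (-(2 * δ * |u t| ^ ρ * u t ^ 2)) t :=
    fun t ht => hasDerivAt_sq_of_ode (hdiff t ht) (hode t ht)
  refine antitoneOn_of_deriv_nonpos (convex_Ioi 0)
    (fun t ht => (hd t ht).continuousAt.continuousWithinAt) ?_ ?_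
  · rw [interior_Ioi]
    exact fun t ht => (hd t ht).differentiableAt.differentiableWithinAt
  · rw [interior_Ioi]
    intro t ht
    rw [(hd t ht).deriv, neg_nonpos]
    positivity

/-- Where a solution does not vanish, `|u| ^ (-ρ)` grows at the constant rate `ρ * δ`. -/
theorem hasDerivAt_sq_rpow_of_ode {δ ρ : ℝ} {u : ℝ → ℝ} {t : ℝ}
    (hdiff : DifferentiableAt ℝ u t) (hode : deriv u t + δ * |u t| ^ ρ * u t = 0)
    (hu : u t ≠ 0) :
    HasDerivAt (fun s => (u s ^ 2) ^ (-(ρ / 2))) (ρ * δ) t := by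
  have hpos : 0 < u t ^ 2 := by positivity
  refine ((hasDerivAt_sq_of_ode hdiff hode).rpow_const
    (p := -(ρ / 2)) (Or.inl hpos.ne')).congr_deriv ?_
  have habs : |u t| ^ ρ = (u t ^ 2) ^ (ρ / 2) := by
    rw [← sq_abs, ← Real.rpow_natCast, ← Real.rpow_mul (abs_nonneg _)]
    congr 1
    push_cast
    ring
  have hprod : (u t ^ 2) ^ (ρ / 2) * u t ^ 2 * (u t ^ 2) ^ (-(ρ / 2) - 1) = 1 := by
    rw [Real.rpow_sub hpos, Real.rpow_neg hpos.le, Real.rpow_one]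
    have := (Real.rpow_pos_of_pos hpos (ρ / 2)).ne'
    field_simp
  rw [habs]
  linear_combination (ρ * δ) * hprod

/-- Universal decay for the scalar ODE `u' + δ |u|^ρ u = 0`. -/
theorem stmt_6 (δ ρ : ℝ) (hδ : 0 < δ) (hρ : 0 < ρ) (u : ℝ → ℝ)
    (hdiff : ∀ t > (0:ℝ), DifferentiableAt ℝ u t)
    (hode : ∀ t > (0:ℝ), deriv u t + δ * |u t| ^ ρ * u t = 0) :
    ∀ t > (0:ℝ), |u t| ≤ (ρ * δ) ^ (-(1 / ρ)) * t ^ (-(1 / ρ)) := by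
  intro t ht
  by_cases hu : u t = 0
  · rw [hu, abs_zero]
    positivity
  have hne : ∀ s, 0 < s → s ≤ t → u s ≠ 0 := by
    intro s hs hst h0
    have h : u t ^ 2 ≤ u s ^ 2 := antitoneOn_sq_of_ode hδ hdiff hode hs ht hst
    rw [h0] at h
    have : 0 < u t ^ 2 := by positivity
    linarith
  have hw : ∀ s, 0 < s → s ≤ t →
      HasDerivAt (fun s => (u s ^ 2) ^ (-(ρ / 2))) (ρ * δ) s := fun s hs hst =>
    hasDerivAt_sq_rpow_of_ode (hdiff s hs) (hode s hs) (hne s hs hst)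
  have hlow : ∀ s, 0 < s → s < t → ρ * δ * (t - s) ≤ (u t ^ 2) ^ (-(ρ / 2)) := by
    intro s hs hst
    obtain ⟨c, -, hc⟩ := exists_hasDerivAt_eq_slope (fun s => (u s ^ 2) ^ (-(ρ / 2)))
      (fun _ => ρ * δ) hst
      (fun x hx => (hw x (hs.trans_le hx.1) hx.2).continuousAt.continuousWithinAt)
      (fun x hx => hw x (hs.trans hx.1) hx.2.le)
    rw [eq_div_iff (sub_pos.2 hst).ne'] at hc
    have : 0 ≤ (u s ^ 2) ^ (-(ρ / 2)) := by positivity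
    linarith
  have hρδ : 0 < ρ * δ := mul_pos hρ hδ
  have hmain : ρ * δ * t ≤ |u t| ^ (-ρ) := by
    have habs : (u t ^ 2) ^ (-(ρ / 2)) = |u t| ^ (-ρ) := by
      rw [← sq_abs, ← Real.rpow_natCast, ← Real.rpow_mul (abs_nonneg _)]
      congr 1
      push_cast
      ring
    rw [← habs]
    by_contra! hlt
    set W := (u t ^ 2) ^ (-(ρ / 2))
    have hW : 0 < W := Real.rpow_pos_of_pos (by positivity) _
    have hs : 0 < (t - W / (ρ * δ)) / 2 := by
      have : W / (ρ * δ) < t := by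
        rw [div_lt_iff₀ hρδ]
        linarith
      linarith
    have hWpos : 0 < W / (ρ * δ) := by positivity
    have h := hlow _ hs (by linarith)
    have e : ρ * δ * (W / (ρ * δ)) = W := by field_simp
    nlinarith
  have hinv := Real.rpow_le_rpow_of_nonpos (mul_pos hρδ ht) hmain
    (neg_nonpos.2 (one_div_pos.2 hρ).le)
  rw [← Real.rpow_mul (abs_nonneg _), show -ρ * -(1 / ρ) = 1 by field_simp, Real.rpow_one,
    Real.mul_rpow hρδ.le ht.le] at hinv
  exact hinv
end

section
/- For all real numbers α, β with 0 < α < β, setting γ = max{α/2, (β−α)/((α+1)(β+2))}, one has γ + 1/(β+2) + 1/2 ≥ 1. -/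
/-- For `0 < α < β`, the exponent `γ_max` satisfies `γ_max + 1/(β+2) + 1/2 ≥ 1`. -/
theorem stmt_9 (α β : ℝ) (hα : 0 < α) (hαβ : α < β) :
    max (α / 2) ((β - α) / ((α + 1) * (β + 2))) + 1 / (β + 2) + 1 / 2 ≥ 1 := by
  have hβ : 0 < β + 2 := by linarith
  have hα' : 0 < α + 1 := by linarith
  have key : β / (2 * (β + 2)) ≤ max (α / 2) ((β - α) / ((α + 1) * (β + 2))) := by
    rcases le_total β (α * (β + 2)) with h | h
    · refine le_max_of_le_left ?_
      rw [div_le_div_iff₀ (by positivity) (by positivity)]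
      linarith
    · refine le_max_of_le_right ?_
      rw [div_le_div_iff₀ (by positivity) (by positivity)]
      nlinarith [mul_nonneg hβ.le (sub_nonneg.2 h)]
  have split : β / (2 * (β + 2)) + 1 / (β + 2) + 1 / 2 = 1 := by
    field_simp
    ring
  linarith
end

section
/- Let ρ, γ be positive real numbers and let Φ : ℝ → ℝ be a function that is nonnegative on [1,∞), Lipschitz continuous on [1,∞), and such that for almost every t > 1 (with respect to Lebesgue measure) Φ is differentiable at t with derivative satisfying Φ'(t) ≤ −ρ·Φ(t)^{1+γ}. Then there exists a real number K (depending only on ρ, γ and Φ(1); one can take K = max{(2/(γρ))^{1/γ}, 2^{1/γ}·Φ(1)}) such that Φ(t) ≤ K·t^{−1/γ} for every t ≥ 1. -/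
open Set MeasureTheory

/-- An absolutely continuous function whose derivative is almost everywhere at least `c` grows at
least at rate `c`. -/
theorem AbsolutelyContinuousOnInterval.mul_sub_le_sub_of_ae_le_hasDerivAt {f : ℝ → ℝ} {a b c : ℝ}
    (hf : AbsolutelyContinuousOnInterval f a b) (hab : a ≤ b)
    (h : ∀ᵐ t, t ∈ Ioc a b → ∃ d, HasDerivAt f d t ∧ c ≤ d) :
    c * (b - a) ≤ f b - f a := by
  rw [← hf.integral_deriv_eq_sub]
  have hconst : ∫ _ in a..b, c = c * (b - a) := by
    rw [intervalIntegral.integral_const, smul_eq_mul, mul_comm]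
  rw [← hconst, intervalIntegral.integral_of_le hab, intervalIntegral.integral_of_le hab]
  refine setIntegral_mono_ae_restrict (intervalIntegrable_const (a := a) (b := b)).1
    hf.intervalIntegrable_deriv.1 ?_
  rw [Filter.EventuallyLE, ae_restrict_iff' measurableSet_Ioc]
  filter_upwards [h] with t ht htm
  obtain ⟨d, hd, hcd⟩ := ht htm
  rwa [hd.deriv]

theorem antitoneOn_Ici_of_lipschitzOnWith_of_ae_hasDerivAt_nonpos {f : ℝ → ℝ} {a : ℝ} {C : NNReal}
    (hf : LipschitzOnWith C f (Ici a))
    (h : ∀ᵐ t, t ∈ Ioi a → ∃ d, HasDerivAt f d t ∧ d ≤ 0) : AntitoneOn f (Ici a) := by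
  intro x hx y _ hxy
  have hac : AbsolutelyContinuousOnInterval (-f) x y :=
    (hf.mono (uIcc_of_le hxy ▸ fun t ht ↦ le_trans hx ht.1)).absolutelyContinuousOnInterval.neg
  have := hac.mul_sub_le_sub_of_ae_le_hasDerivAt (c := 0) hxy (by
    filter_upwards [h] with t ht htm
    obtain ⟨d, hd, hd0⟩ := ht (lt_of_le_of_lt hx htm.1)
    exact ⟨-d, hd.neg, neg_nonneg.2 hd0⟩)
  simp only [zero_mul, Pi.neg_apply] at this
  linarith

/-- A positive Lipschitz solution of `f' ≤ -ρ f^{1+γ}` satisfies `(f^{-γ})' ≥ γ ρ`, in integrated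
form. -/
theorem rpow_neg_add_le_of_ae_hasDerivAt_le {f : ℝ → ℝ} {a b ρ γ : ℝ} {C : NNReal} (hab : a ≤ b)
    (hγ : 0 < γ) (hf : LipschitzOnWith C f (Icc a b)) (hanti : AntitoneOn f (Icc a b))
    (hpos : 0 < f b)
    (h : ∀ᵐ t, t ∈ Ioc a b → ∃ d, HasDerivAt f d t ∧ d ≤ -ρ * f t ^ (1 + γ)) :
    f a ^ (-γ) + γ * ρ * (b - a) ≤ f b ^ (-γ) := by
  have hmaps : MapsTo f (Icc a b) (Icc (f b) (f a)) := fun t ht ↦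
    ⟨hanti ht (right_mem_Icc.2 hab) ht.2, hanti (left_mem_Icc.2 hab) ht ht.1⟩
  have hsmooth : ContDiffOn ℝ 1 (fun x : ℝ ↦ x ^ (-γ)) (Icc (f b) (f a)) := fun x hx ↦
    (Real.contDiffAt_rpow_const_of_ne (hpos.trans_le hx.1).ne').contDiffWithinAt
  obtain ⟨M, hM⟩ := hsmooth.exists_lipschitzOnWith (by decide) (convex_Icc _ _) isCompact_Icc
  have hlip := hM.comp hf hmaps
  rw [← uIcc_of_le hab] at hlip
  have := hlip.absolutelyContinuousOnInterval.mul_sub_le_sub_of_ae_le_hasDerivAt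
    (c := γ * ρ) hab (by
      filter_upwards [h] with t ht htm
      obtain ⟨d, hd, hdle⟩ := ht htm
      have hft : 0 < f t := hpos.trans_le (hmaps (Ioc_subset_Icc_self htm)).1
      refine ⟨_, hd.rpow_const (p := -γ) (Or.inl hft.ne'), ?_⟩
      have hmul : f t ^ (1 + γ) * f t ^ (-γ - 1) = 1 := by
        rw [← Real.rpow_add hft]; ring_nf; exact Real.rpow_zero _
      have hq : 0 < f t ^ (-γ - 1) := Real.rpow_pos_of_pos hft _
      calc γ * ρ = -(-ρ * f t ^ (1 + γ)) * (γ * f t ^ (-γ - 1)) := by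
            linear_combination (-γ * ρ) * hmul
        _ ≤ -d * (γ * f t ^ (-γ - 1)) := by gcongr
        _ = d * -γ * f t ^ (-γ - 1) := by ring)
  simp only [Function.comp_apply] at this
  linarith

/-- Universal decay for the differential inequality `Φ' ≤ -ρ Φ^{1+γ}` on `[1,∞)`:
`Φ(t) ≤ K t^{-1/γ}` with `K = max {(2/(γρ))^{1/γ}, 2^{1/γ} Φ(1)}`. -/
theorem stmt_15 (ρ γ : ℝ) (hρ : 0 < ρ) (hγ : 0 < γ) (Φ : ℝ → ℝ)
    (hnn : ∀ t ∈ Ici (1:ℝ), 0 ≤ Φ t)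
    (hlip : ∃ K : NNReal, LipschitzOnWith K Φ (Ici (1:ℝ)))
    (hode : ∀ᵐ t ∂(volume : Measure ℝ), t ∈ Ioi (1:ℝ) →
      ∃ d : ℝ, HasDerivAt Φ d t ∧ d ≤ -ρ * Φ t ^ (1 + γ)) :
    ∃ K : ℝ, K = max ((2 / (γ * ρ)) ^ (1 / γ)) (2 ^ (1 / γ) * Φ 1) ∧
      ∀ t ≥ (1:ℝ), Φ t ≤ K * t ^ (-(1 / γ)) := by
  refine ⟨_, rfl, fun t ht ↦ ?_⟩
  obtain ⟨C, hC⟩ := hlip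
  have hanti : AntitoneOn Φ (Ici 1) := by
    refine antitoneOn_Ici_of_lipschitzOnWith_of_ae_hasDerivAt_nonpos hC ?_
    filter_upwards [hode] with s hs hs1
    obtain ⟨d, hd, hle⟩ := hs hs1
    have := mul_nonneg hρ.le (Real.rpow_nonneg (hnn s (Ioi_subset_Ici_self hs1)) (1 + γ))
    exact ⟨d, hd, by linarith⟩
  have ht0 : 0 < t := by linarith
  have hΦ1 : 0 ≤ Φ 1 := hnn 1 self_mem_Ici
  have htpow : 0 < t ^ (-(1 / γ)) := Real.rpow_pos_of_pos ht0 _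
  rcases (hnn t ht).eq_or_lt with h0 | hpos
  · rw [← h0]
    positivity
  rcases le_total t 2 with h2 | h2
  · calc Φ t ≤ 1 * Φ 1 := by simpa using hanti self_mem_Ici ht ht
      _ ≤ (2 / t) ^ (1 / γ) * Φ 1 := by
        gcongr
        exact Real.one_le_rpow ((one_le_div ht0).2 h2) (by positivity)
      _ = 2 ^ (1 / γ) * Φ 1 * t ^ (-(1 / γ)) := by
        rw [Real.div_rpow zero_le_two ht0.le, Real.rpow_neg ht0.le]
        ring
      _ ≤ _ := by gcongr; exact le_max_right _ _
  · have hgrow := rpow_neg_add_le_of_ae_hasDerivAt_le (ρ := ρ) ht hγ (hC.mono Icc_subset_Ici_self)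
      (hanti.mono Icc_subset_Ici_self) hpos (by
        filter_upwards [hode] with s hs hs1 using hs hs1.1)
    have hlow : γ * ρ * t / 2 ≤ Φ t ^ (-γ) := by
      have : γ * ρ * (t / 2) ≤ γ * ρ * (t - 1) := by gcongr; linarith
      have := Real.rpow_nonneg hΦ1 (-γ)
      linarith
    calc Φ t = (Φ t ^ (-γ)) ^ (-(1 / γ)) := by
          rw [← Real.rpow_mul hpos.le, neg_mul_neg, mul_one_div_cancel hγ.ne', Real.rpow_one]
      _ ≤ (γ * ρ * t / 2) ^ (-(1 / γ)) :=
        Real.rpow_le_rpow_of_nonpos (by positivity) hlow (by simp [hγ.le])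
      _ = (2 / (γ * ρ)) ^ (1 / γ) * t ^ (-(1 / γ)) := by
        rw [mul_div_right_comm, Real.mul_rpow (by positivity) ht0.le,
          Real.rpow_neg (by positivity), ← Real.inv_rpow (by positivity), inv_div]
      _ ≤ _ := by gcongr; exact le_max_left _ _
end

section
/- Let α, β be real numbers with 0 < α < β. Then there exist real numbers Γ and Γ* (depending only on α and β, not on T or on the solution) such that for every T > 0 and every twice differentiable function u : (0,T) → ℝ satisfying u''(t) + |u'(t)|^{α}u'(t) + |u(t)|^{β}u(t) = 0 for all t ∈ (0,T), one has ½·u'(t)² + |u(t)|^{β+2}/(β+2) ≤ Γ·t^{−1/γ} + Γ* for every t ∈ (0,T), where γ = min{α/2, (β−α)/((α+1)(β+2))}. -/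
open Set

lemma hasDerivAt_abs_rpow_mul_self {p : ℝ} (hp : 0 < p) (x : ℝ) :
    HasDerivAt (fun y : ℝ => |y| ^ p * y) ((p + 1) * |x| ^ p) x := by
  have hne : ∀ y : ℝ, y ≠ 0 → HasDerivAt (fun y : ℝ => |y| ^ p * y) ((p + 1) * |y| ^ p) y := by
    intro y hy
    have hy' : 0 < |y| := abs_pos.2 hy
    have h := (((hasDerivAt_abs hy).rpow_const (p := p) (Or.inl hy'.ne')).mul (hasDerivAt_id y))
    refine h.congr_deriv ?_
    have h1 : |y| ^ p = |y| ^ (p - 1) * |y| := by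
      rw [← Real.rpow_add_one hy'.ne']; ring_nf
    have h2 : (SignType.sign y : ℝ) * y = |y| := sign_mul_self y
    simp only [id]
    rw [h1, ← h2]; ring
  have hcont : Continuous (fun y : ℝ => |y| ^ p) :=
    continuous_abs.rpow_const (fun _ => Or.inr hp.le)
  rcases eq_or_ne x 0 with rfl | hx
  · exact hasDerivAt_of_hasDerivAt_of_ne (fun y hy => hne y hy)
      (hcont.mul continuous_id).continuousAt (hcont.const_mul (p + 1)).continuousAt
  · exact hne x hx

lemma rpow_le_one_add_rpow {x a b : ℝ} (hx : 0 ≤ x) (ha : 0 ≤ a) (hab : a ≤ b) :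
    x ^ a ≤ 1 + x ^ b := by
  rcases le_total x 1 with h | h
  · linarith [Real.rpow_le_one hx h ha, Real.rpow_nonneg hx b]
  · linarith [Real.rpow_le_rpow_of_exponent_le h hab]

lemma exists_young_inequality {p q δ : ℝ} (hpq : p.HolderConjugate q) (hδ : 0 < δ) :
    ∃ C ≥ 0, ∀ a b : ℝ, 0 ≤ a → 0 ≤ b → a * b ≤ δ * a ^ p + C * b ^ q := by
  have hη : 0 < δ ^ (1 / p) := Real.rpow_pos_of_pos hδ _
  have hηp : (δ ^ (1 / p)) ^ p = δ := by
    rw [← Real.rpow_mul hδ.le, one_div_mul_cancel hpq.pos.ne', Real.rpow_one]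
  set η := δ ^ (1 / p)
  refine ⟨(η⁻¹) ^ q, by positivity, fun a b ha hb => ?_⟩
  have h := Real.young_inequality_of_nonneg (a := η * a) (b := η⁻¹ * b)
    (by positivity) (by positivity) hpq
  have e : η * a * (η⁻¹ * b) = a * b := by field_simp
  rw [e, Real.mul_rpow hη.le ha, Real.mul_rpow (inv_nonneg.2 hη.le) hb, hηp] at h
  have h1 : δ * a ^ p / p ≤ δ * a ^ p := div_le_self (by positivity) hpq.lt.le
  have h2 : (η⁻¹) ^ q * b ^ q / q ≤ (η⁻¹) ^ q * b ^ q :=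
    div_le_self (by positivity) hpq.symm.lt.le
  linarith

lemma add_add_rpow_le {a b c q : ℝ} (ha : 0 ≤ a) (hb : 0 ≤ b) (hc : 0 ≤ c) (hq : 0 ≤ q) :
    (a + b + c) ^ q ≤ 3 ^ q * (a ^ q + b ^ q + c ^ q) := by
  have key : ∀ m : ℝ, 0 ≤ m → a ≤ m → b ≤ m → c ≤ m → (a + b + c) ^ q ≤ 3 ^ q * m ^ q := by
    intro m hm h1 h2 h3
    rw [← Real.mul_rpow (by norm_num) hm]
    exact Real.rpow_le_rpow (by positivity) (by linarith) hq
  have hA := Real.rpow_nonneg ha q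
  have hB := Real.rpow_nonneg hb q
  have hC := Real.rpow_nonneg hc q
  rcases le_total a b with h1 | h1 <;> rcases le_total b c with h2 | h2 <;>
    rcases le_total a c with h3 | h3
  all_goals first
    | exact (key a ha le_rfl (by linarith) (by linarith)).trans (by gcongr; linarith)
    | exact (key b hb (by linarith) le_rfl (by linarith)).trans (by gcongr; linarith)
    | exact (key c hc (by linarith) (by linarith) le_rfl).trans (by gcongr; linarith)

/-- A positive solution of `G' ≤ -c G ^ (1 + γ) + C` satisfies a bound independent of its
initial value. -/
lemma le_of_deriv_le_neg_rpow_add {c C γ T : ℝ} (hc : 0 < c) (hC : 0 ≤ C) (hγ : 0 < γ)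
    {G G' : ℝ → ℝ} (hG : ∀ t ∈ Ioo 0 T, HasDerivAt G (G' t) t) (hpos : ∀ t ∈ Ioo 0 T, 0 < G t)
    (hG' : ∀ t ∈ Ioo 0 T, G' t ≤ -c * G t ^ (1 + γ) + C) :
    ∀ t ∈ Ioo 0 T,
      G t ≤ (γ * c / 4) ^ (-(1 / γ)) * t ^ (-(1 / γ)) + (2 * (C + 1) / c) ^ (1 / (1 + γ)) := by
  intro t ht
  set B := (2 * (C + 1) / c) ^ (1 / (1 + γ)) with hB
  have hB0 : 0 < B := by positivity
  have hBp : B ^ (1 + γ) = 2 * (C + 1) / c := by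
    rw [hB, ← Real.rpow_mul (by positivity), one_div_mul_cancel (by positivity), Real.rpow_one]
  have hk : 0 < γ * c / 4 := by positivity
  have ht0 := ht.1
  have hneg : ∀ s ∈ Ioo 0 T, B ≤ G s → G' s ≤ -(c / 2) * G s ^ (1 + γ) ∧ G' s < 0 := by
    intro s hs h
    have h1 : 2 * (C + 1) / c ≤ G s ^ (1 + γ) :=
      hBp ▸ Real.rpow_le_rpow hB0.le h (by positivity)
    rw [div_le_iff₀ hc] at h1
    have h2 := hG' s hs
    constructor <;> nlinarith
  by_cases hle : G t ≤ B
  · have : 0 ≤ (γ * c / 4) ^ (-(1 / γ)) * t ^ (-(1 / γ)) := by positivity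
    linarith
  have hgt : ∀ s ∈ Ioc 0 t, B ≤ G s := by
    intro s hs
    by_contra! hlt
    have hsub : ∀ r ∈ Icc s t, r ∈ Ioo 0 T := fun r hr =>
      ⟨hs.1.trans_le hr.1, hr.2.trans_lt ht.2⟩
    refine hle (image_le_of_deriv_right_lt_deriv_boundary (f := G) (f' := G') (a := s) (b := t)
      (B := fun _ => B) (B' := fun _ => 0)
      (fun r hr => (hG r (hsub r hr)).continuousAt.continuousWithinAt)
      (fun r hr => (hG r (hsub r ⟨hr.1, hr.2.le⟩)).hasDerivWithinAt) hlt.le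
      (fun r => hasDerivAt_const r B)
      (fun r hr he => (hneg r (hsub r ⟨hr.1, hr.2.le⟩) he.ge).2) ⟨hs.2, le_rfl⟩)
  have hsub : ∀ r ∈ Icc (t / 2) t, r ∈ Ioo 0 T ∧ r ∈ Ioc 0 t := fun r hr =>
    ⟨⟨by linarith [hr.1], hr.2.trans_lt ht.2⟩, ⟨by linarith [hr.1], hr.2⟩⟩
  have hH : ∀ r ∈ Icc (t / 2) t,
      HasDerivAt (fun r => G r ^ (-γ)) (G' r * (-γ) * G r ^ (-γ - 1)) r := fun r hr =>
    (hG r (hsub r hr).1).rpow_const (Or.inl (hpos r (hsub r hr).1).ne')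
  have hmvt := Convex.mul_sub_le_image_sub_of_le_deriv (convex_Icc (t / 2) t)
    (f := fun r => G r ^ (-γ)) (C := γ * c / 2)
    (fun r hr => (hH r hr).continuousAt.continuousWithinAt)
    (fun r hr => (hH r (interior_subset hr)).differentiableAt.differentiableWithinAt)
    (fun r hr => by
      have hr' := interior_subset hr
      rw [(hH r hr').deriv]
      have hp := hpos r (hsub r hr').1
      have h1 := (hneg r (hsub r hr').1 (hgt r (hsub r hr').2)).1
      have h2 : G r ^ (1 + γ) * G r ^ (-γ - 1) = 1 := by
        rw [← Real.rpow_add hp]; ring_nf; exact Real.rpow_zero _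
      have h3 : 0 < γ * G r ^ (-γ - 1) := by positivity
      have h4 := mul_le_mul_of_nonneg_right h1 h3.le
      have h5 : -(c / 2) * G r ^ (1 + γ) * (γ * G r ^ (-γ - 1)) = -(γ * c / 2) := by
        linear_combination (-(c / 2) * γ) * h2
      linarith)
    (t / 2) ⟨le_rfl, by linarith⟩ t ⟨by linarith, le_rfl⟩ (by linarith)
  have hp := hpos t ht
  have hhalf : 0 ≤ G (t / 2) ^ (-γ) :=
    Real.rpow_nonneg (hpos _ (hsub _ ⟨le_rfl, by linarith⟩).1).le _
  have hlow : γ * c / 4 * t ≤ G t ^ (-γ) := by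
    have hmvt' : γ * c / 2 * (t - t / 2) ≤ G t ^ (-γ) - G (t / 2) ^ (-γ) := hmvt
    linarith
  have hfin := Real.rpow_le_rpow_of_nonpos (z := -(1 / γ)) (by positivity) hlow
    (neg_nonpos.2 (by positivity))
  rw [← Real.rpow_mul hp.le, Real.mul_rpow hk.le ht0.le] at hfin
  have he : -γ * -(1 / γ) = 1 := by field_simp
  rw [he, Real.rpow_one] at hfin
  linarith

/-- The dissipation of the energy modified by a small multiple of `|u| ^ p * u * u'`, in terms of
`x = |u|` and `y = |u'|`. -/
lemma exists_dissipation_le {α β p : ℝ} (hα : 0 < α) (hp : 0 < p)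
    (hp1 : p ≤ α * (β + 2) / 2) (hp2 : p * (α + 1) ≤ β - α) :
    ∃ C ≥ 0, ∀ x y : ℝ, 0 ≤ x → 0 ≤ y →
      (p + 1) * x ^ p * y ^ 2 + x ^ (p + 1) * y ^ (α + 1) - x ^ (β + p + 2)
        ≤ 1 / 2 - x ^ (β + p + 2) / 2 + C * y ^ (α + 2) := by
  have hc1 : ((α + 2) / α).HolderConjugate ((α + 2) / 2) :=
    Real.holderConjugate_iff.2 ⟨by rw [lt_div_iff₀ hα]; linarith, by field_simp⟩
  have hc2 : (α + 2).HolderConjugate ((α + 2) / (α + 1)) :=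
    Real.holderConjugate_iff.2 ⟨by linarith, by field_simp; ring⟩
  obtain ⟨C₁, hC₁, h₁⟩ := exists_young_inequality hc1 (δ := 1 / (4 * (p + 1))) (by positivity)
  obtain ⟨C₂, hC₂, h₂⟩ := exists_young_inequality hc2 (δ := 1 / 4) (by positivity)
  refine ⟨(p + 1) * C₁ + C₂, by positivity, fun x y hx hy => ?_⟩
  have k1 := h₁ (x ^ p) (y ^ 2) (by positivity) (by positivity)
  have k2 := h₂ (x ^ (p + 1)) (y ^ (α + 1)) (by positivity) (by positivity)
  have e1 : (y ^ 2) ^ ((α + 2) / 2) = y ^ (α + 2) := by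
    rw [← Real.rpow_natCast, ← Real.rpow_mul hy]; congr 1; push_cast; ring
  have e2 : (y ^ (α + 1)) ^ ((α + 2) / (α + 1)) = y ^ (α + 2) := by
    rw [← Real.rpow_mul hy]; congr 1; field_simp
  have i1 : (x ^ p) ^ ((α + 2) / α) ≤ 1 + x ^ (β + p + 2) := by
    rw [← Real.rpow_mul hx]
    refine rpow_le_one_add_rpow hx (by positivity) ?_
    rw [mul_div_assoc', div_le_iff₀ hα]; nlinarith
  have i2 : (x ^ (p + 1)) ^ (α + 2) ≤ 1 + x ^ (β + p + 2) := by
    rw [← Real.rpow_mul hx]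
    exact rpow_le_one_add_rpow hx (by positivity) (by nlinarith)
  rw [e1] at k1
  rw [e2] at k2
  have k1' : (p + 1) * (x ^ p * y ^ 2)
      ≤ 1 / 4 * (x ^ p) ^ ((α + 2) / α) + (p + 1) * C₁ * y ^ (α + 2) := by
    have := mul_le_mul_of_nonneg_left k1 (by positivity : 0 ≤ p + 1)
    refine this.trans_eq ?_
    field_simp
  linarith

/-- With `x = |u|` and `y = |u'|`, the cross term `|u| ^ p * u * u'` is controlled by the
energy. -/
lemma rpow_mul_le_energy {β p x y : ℝ} (hβ : 0 < β) (hp : 0 < p) (hpβ : p ≤ β / 2)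
    (hx : 0 ≤ x) :
    x ^ (p + 1) * y ≤ 1 + (β + 2) * (1 / 2 * y ^ 2 + x ^ (β + 2) / (β + 2)) := by
  have h1 : (x ^ (p + 1)) ^ 2 ≤ 1 + x ^ (β + 2) := by
    rw [← Real.rpow_natCast, ← Real.rpow_mul hx]
    exact rpow_le_one_add_rpow hx (by positivity) (by push_cast; linarith)
  have h2 : (β + 2) * (x ^ (β + 2) / (β + 2)) = x ^ (β + 2) := by field_simp
  have h3 : 0 ≤ x ^ (β + 2) := by positivity
  nlinarith [sq_nonneg (x ^ (p + 1) - y), mul_nonneg hβ.le (sq_nonneg y)]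

/-- Universal bound for solutions of the scalar ODE `u'' + |u'|^α u' + |u|^β u = 0`
in the regime `0 < α < β`: the energy is bounded by `Γ t^{-1/γ} + Γ*` with constants
independent of `T` and of the solution. -/
theorem stmt_16 (α β : ℝ) (hα : 0 < α) (hαβ : α < β) :
    ∃ Γ Γstar : ℝ, ∀ T > (0:ℝ), ∀ u : ℝ → ℝ,
      (∀ t ∈ Ioo (0:ℝ) T, DifferentiableAt ℝ u t) →
      (∀ t ∈ Ioo (0:ℝ) T, DifferentiableAt ℝ (deriv u) t) →
      (∀ t ∈ Ioo (0:ℝ) T,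
        deriv (deriv u) t + |deriv u t| ^ α * deriv u t + |u t| ^ β * u t = 0) →
      ∀ t ∈ Ioo (0:ℝ) T,
        (1 / 2) * (deriv u t) ^ 2 + |u t| ^ (β + 2) / (β + 2)
          ≤ Γ * t ^ (-(1 / min (α / 2) ((β - α) / ((α + 1) * (β + 2))))) + Γstar := by
  have hβ : 0 < β := hα.trans hαβ
  have hγ : 0 < min (α / 2) ((β - α) / ((α + 1) * (β + 2))) :=
    lt_min (by positivity) (div_pos (sub_pos.2 hαβ) (by positivity))
  have hγ1 := min_le_left (α / 2) ((β - α) / ((α + 1) * (β + 2)))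
  have hγ2 := min_le_right (α / 2) ((β - α) / ((α + 1) * (β + 2)))
  set γ := min (α / 2) ((β - α) / ((α + 1) * (β + 2)))
  rw [le_div_iff₀ (by positivity)] at hγ2
  obtain ⟨p, hpγ⟩ : ∃ p, p = γ * (β + 2) := ⟨_, rfl⟩
  have hp : 0 < p := by rw [hpγ]; positivity
  have hp1 : p ≤ α * (β + 2) / 2 := by rw [hpγ]; nlinarith
  have hp2 : p * (α + 1) ≤ β - α := by rw [hpγ]; linarith
  have hpβ : p ≤ β / 2 := by
    rcases le_total (α * (β + 2)) β with h | h
    · linarith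
    · by_contra! hlt
      nlinarith
  obtain ⟨C, hC, hdiss⟩ := exists_dissipation_le hα hp hp1 hp2
  obtain ⟨ε, hε, hεC, hεβ⟩ : ∃ ε > 0, ε * C ≤ 1 / 2 ∧ ε * (β + 2) ≤ 1 / 2 := by
    refine ⟨1 / (2 * (C + β + 2)), by positivity, ?_, ?_⟩ <;>
    · rw [div_mul_eq_mul_div, div_le_iff₀ (by positivity)]; linarith
  set c := ε / 2 / 9 ^ (1 + γ) with hc
  have hc0 : 0 < c := by positivity
  refine ⟨2 * (γ * c / 4) ^ (-(1 / γ)), 2 * (2 * (3 * ε / 2 + 1) / c) ^ (1 / (1 + γ)), ?_⟩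
  intro T _ u hu hv hode
  set v := deriv u with hvdef
  set E : ℝ → ℝ := fun t => 1 / 2 * v t ^ 2 + |u t| ^ (β + 2) / (β + 2) with hE
  set G : ℝ → ℝ := fun t => E t + ε * (|u t| ^ p * u t * v t) + 2 with hG
  have hcross : ∀ t, |ε * (|u t| ^ p * u t * v t)| ≤ 1 / 2 + E t / 2 := by
    intro t
    have h := rpow_mul_le_energy hβ hp hpβ (y := |v t|) (abs_nonneg (u t))
    rw [sq_abs] at h
    have e : |ε * (|u t| ^ p * u t * v t)| = ε * (|u t| ^ (p + 1) * |v t|) := by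
      rw [abs_mul, abs_mul, abs_mul, abs_of_pos hε, abs_of_nonneg (by positivity : 0 ≤ |u t| ^ p),
        Real.rpow_add_one' (abs_nonneg _) (by positivity)]
    have hE0 : 0 ≤ E t := by positivity
    rw [e]
    calc ε * (|u t| ^ (p + 1) * |v t|) ≤ ε * (1 + (β + 2) * E t) :=
          mul_le_mul_of_nonneg_left h hε.le
      _ ≤ 1 / 2 + E t / 2 := by nlinarith
  have hGlow : ∀ t, E t ≤ 2 * G t ∧ 0 < G t := by
    intro t
    have h := (abs_le.1 (hcross t)).1
    have hE0 : 0 ≤ E t := by positivity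
    simp only [hG]
    constructor <;> linarith
  have hGpow : ∀ t, G t ^ (1 + γ)
      ≤ 9 ^ (1 + γ) * (|u t| ^ (β + p + 2) + |v t| ^ (α + 2) + 2) := by
    intro t
    have hup : G t ≤ 3 * (|u t| ^ (β + 2) + |v t| ^ 2 + 1) := by
      have h := (abs_le.1 (hcross t)).2
      have h1 : |u t| ^ (β + 2) / (β + 2) ≤ |u t| ^ (β + 2) :=
        div_le_self (by positivity) (by linarith)
      have h2 : E t ≤ |v t| ^ 2 + |u t| ^ (β + 2) := by
        simp only [hE]; rw [sq_abs]; nlinarith [sq_nonneg (v t)]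
      have h3 : 0 ≤ |v t| ^ 2 + |u t| ^ (β + 2) := by positivity
      simp only [hG]
      linarith
    have hq : 0 ≤ 1 + γ := by positivity
    have h1 := Real.rpow_le_rpow (hGlow t).2.le hup hq
    rw [Real.mul_rpow (by norm_num) (by positivity)] at h1
    have h2 := add_add_rpow_le (a := |u t| ^ (β + 2)) (b := |v t| ^ 2) (c := 1)
      (by positivity) (by positivity) zero_le_one hq
    have e1 : (|u t| ^ (β + 2)) ^ (1 + γ) = |u t| ^ (β + p + 2) := by
      rw [← Real.rpow_mul (abs_nonneg _), hpγ]; ring_nf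
    have e2 : (|v t| ^ 2) ^ (1 + γ) ≤ 1 + |v t| ^ (α + 2) := by
      rw [← Real.rpow_natCast, ← Real.rpow_mul (abs_nonneg _)]
      exact rpow_le_one_add_rpow (abs_nonneg _) (by positivity) (by push_cast; linarith)
    rw [e1, Real.one_rpow] at h2
    have e9 : (9 : ℝ) ^ (1 + γ) = 3 ^ (1 + γ) * 3 ^ (1 + γ) := by
      rw [← Real.mul_rpow (by norm_num) (by norm_num)]; norm_num
    rw [e9, mul_assoc]
    refine h1.trans (mul_le_mul_of_nonneg_left (h2.trans ?_) (by positivity))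
    exact mul_le_mul_of_nonneg_left (by linarith) (by positivity)
  have hderiv : ∀ t ∈ Ioo 0 T, HasDerivAt G (-|v t| ^ (α + 2) + ε * ((p + 1) * |u t| ^ p * |v t| ^ 2
      - (|u t| ^ p * u t) * (|v t| ^ α * v t) - |u t| ^ (β + p + 2))) t := by
    intro t ht
    have du : HasDerivAt u (v t) t := (hu t ht).hasDerivAt
    have dv : HasDerivAt v (-(|v t| ^ α * v t) - |u t| ^ β * u t) t :=
      (hv t ht).hasDerivAt.congr_deriv (by linarith [hode t ht])
    have d1 := (hasDerivAt_abs_rpow (u t) (by linarith : 1 < β + 2)).comp t du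
    have d2 := (hasDerivAt_abs_rpow_mul_self hp (u t)).comp t du
    have d := ((((dv.pow 2).const_mul (1 / 2)).add (d1.div_const (β + 2))).add
      ((d2.mul dv).const_mul ε)).add_const 2
    refine d.congr_deriv ?_
    have e1 : |v t| ^ (α + 2) = |v t| ^ α * v t ^ 2 := by
      rw [Real.rpow_add' (abs_nonneg _) (by positivity), Real.rpow_two, sq_abs]
    have e2 : |u t| ^ (β + p + 2) = |u t| ^ β * |u t| ^ p * u t ^ 2 := by
      rw [Real.rpow_add' (abs_nonneg _) (by positivity), Real.rpow_add' (abs_nonneg _)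
        (by positivity), Real.rpow_two, sq_abs]
    have e3 : β + 2 - 2 = β := by ring
    rw [e1, e2, e3, sq_abs]
    simp only [Function.comp]
    field_simp
    ring
  have hGbound : ∀ t ∈ Ioo 0 T, -|v t| ^ (α + 2) + ε * ((p + 1) * |u t| ^ p * |v t| ^ 2
      - (|u t| ^ p * u t) * (|v t| ^ α * v t) - |u t| ^ (β + p + 2))
      ≤ -c * G t ^ (1 + γ) + 3 * ε / 2 := by
    intro t _
    have h := hdiss |u t| |v t| (abs_nonneg _) (abs_nonneg _)
    have h1 : -((|u t| ^ p * u t) * (|v t| ^ α * v t)) ≤ |u t| ^ (p + 1) * |v t| ^ (α + 1) := by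
      refine (neg_le_abs _).trans_eq ?_
      rw [abs_mul, abs_mul, abs_mul, abs_of_nonneg (by positivity : 0 ≤ |u t| ^ p),
        abs_of_nonneg (by positivity : 0 ≤ |v t| ^ α),
        Real.rpow_add_one' (abs_nonneg _) (by positivity),
        Real.rpow_add_one' (abs_nonneg _) (by positivity)]
    have h2 : c * G t ^ (1 + γ) ≤ ε / 2 * (|u t| ^ (β + p + 2) + |v t| ^ (α + 2) + 2) := by
      rw [hc, div_mul_eq_mul_div, div_le_iff₀ (by positivity)]
      have := mul_le_mul_of_nonneg_left (hGpow t) (by positivity : 0 ≤ ε / 2)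
      linarith
    have hY : 0 ≤ |v t| ^ (α + 2) := by positivity
    have h3 := mul_le_mul_of_nonneg_left (sub_le_sub_right (add_le_add_right h1
      ((p + 1) * |u t| ^ p * |v t| ^ 2)) (|u t| ^ (β + p + 2))) hε.le
    have h4 := mul_le_mul_of_nonneg_left h hε.le
    have h5 := mul_le_mul_of_nonneg_right hεC hY
    nlinarith
  intro t ht
  have h := le_of_deriv_le_neg_rpow_add hc0 (by positivity) hγ hderiv (fun t _ => (hGlow t).2)
    hGbound t ht
  have h' := (hGlow t).1
  calc E t ≤ 2 * G t := h'
    _ ≤ _ := by linarith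
end

section
/- Let α, β be real numbers with 0 < α < β. Then there exists a real number C (depending only on α and β, not on the solution) such that for every twice differentiable function u : (0,∞) → ℝ satisfying u''(t) + |u'(t)|^{α}u'(t) + |u(t)|^{β}u(t) = 0 for all t > 0, one has ½·u'(t)² + |u(t)|^{β+2}/(β+2) ≤ C·max{t^{−2/α}, t^{−(α+1)(β+2)/(β−α)}} for every t > 0. -/
open Set

/-- The energy at position `x` and velocity `y`. -/
noncomputable def energy (β x y : ℝ) : ℝ := (1 / 2) * y ^ 2 + |x| ^ (β + 2) / (β + 2)

/-- The time scale on which a solution of energy `e` loses a fixed fraction of its energy. -/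
noncomputable def decayTime (α β e : ℝ) : ℝ :=
  max (e ^ (-(α / 2))) (e ^ (-((β - α) / ((β + 2) * (α + 1)))))

theorem decayTime_pos (α β : ℝ) {e : ℝ} (he : 0 < e) : 0 < decayTime α β e :=
  lt_max_of_lt_left (Real.rpow_pos_of_pos he _)

theorem abs_mul_abs_rpow {p : ℝ} (hp : 0 < p) (y : ℝ) : |y| ^ p * |y| = |y| ^ (p + 1) := by
  rw [Real.rpow_add_one' (abs_nonneg y) (by linarith)]

theorem abs_rpow_mul_sq {p : ℝ} (hp : 0 < p) (y : ℝ) : |y| ^ p * y ^ 2 = |y| ^ (p + 2) := by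
  rw [Real.rpow_add' (abs_nonneg y) (by linarith), Real.rpow_two, sq_abs]

theorem energy_nonneg {β : ℝ} (hβ : 0 < β) (x y : ℝ) : 0 ≤ energy β x y := by
  unfold energy; positivity

theorem abs_le_of_energy_le {β e x y : ℝ} (hβ : 0 < β) (he : 0 < e) (h : energy β x y ≤ 2 * e) :
    |x| ≤ (2 * (β + 2)) ^ (1 / (β + 2)) * e ^ (1 / (β + 2)) := by
  have hb : 0 < β + 2 := by linarith
  have h1 : |x| ^ (β + 2) ≤ 2 * (β + 2) * e := by
    have : |x| ^ (β + 2) / (β + 2) ≤ 2 * e := by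
      unfold energy at h; nlinarith [sq_nonneg y]
    rw [div_le_iff₀ hb] at this; linarith
  rw [← Real.mul_rpow (by positivity) he.le, one_div]
  exact (Real.le_rpow_inv_iff_of_pos (abs_nonneg x) (by positivity) hb).2 h1

theorem abs_velocity_le_of_energy_le {β e x y : ℝ} (hβ : 0 < β) (he : 0 < e)
    (h : energy β x y ≤ 2 * e) : |y| ≤ 2 * e ^ (1 / 2 : ℝ) := by
  have h1 : y ^ 2 ≤ 4 * e := by
    have : 0 ≤ |x| ^ (β + 2) / (β + 2) := by positivity
    unfold energy at h; linarith
  rw [← Real.sqrt_eq_rpow]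
  refine abs_le_of_sq_le_sq ?_ (by positivity)
  rw [mul_pow, Real.sq_sqrt he.le]; linarith

theorem rpow_neg_le_max {e p q r : ℝ} (he : 0 < e) (h : p ≤ r ∧ r ≤ q ∨ q ≤ r ∧ r ≤ p) :
    e ^ (-r) ≤ max (e ^ (-p)) (e ^ (-q)) := by
  rcases le_total 1 e with h1 | h1
  · rcases h with h | h
    · exact le_max_of_le_left (Real.rpow_le_rpow_of_exponent_le h1 (by linarith))
    · exact le_max_of_le_right (Real.rpow_le_rpow_of_exponent_le h1 (by linarith))
  · rcases h with h | h
    · exact le_max_of_le_right (Real.rpow_le_rpow_of_exponent_ge he h1 (by linarith))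
    · exact le_max_of_le_left (Real.rpow_le_rpow_of_exponent_ge he h1 (by linarith))

theorem rpow_boundary_le_decayTime {α β e : ℝ} (hα : 0 < α) (hαβ : α < β) (he : 0 < e) :
    e ^ (1 / (β + 2)) * e ^ (1 / 2 : ℝ) ≤ e * decayTime α β e := by
  have hb : 0 < β + 2 := by linarith
  have h1 : e ^ (1 / (β + 2)) * e ^ (1 / 2 : ℝ) = e * e ^ (-(β / (2 * (β + 2)))) := by
    rw [← Real.rpow_add he, ← Real.rpow_one_add' he.le]
    · congr 1; field_simp; ring
    · have : β / (2 * (β + 2)) < 1 := by rw [div_lt_one (by positivity)]; linarith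
      linarith
  rw [h1]
  refine mul_le_mul_of_nonneg_left (rpow_neg_le_max he ?_) he.le
  rcases le_total (α * (β + 2)) β with h | h
  · left
    constructor
    · rw [div_le_div_iff₀ (by positivity) (by positivity)]; nlinarith
    · rw [div_le_div_iff₀ (by positivity) (by positivity)]; nlinarith
  · right
    constructor
    · rw [div_le_div_iff₀ (by positivity) (by positivity)]; nlinarith
    · rw [div_le_div_iff₀ (by positivity) (by positivity)]; nlinarith

theorem exists_abs_mul_abs_le {α β : ℝ} (hα : 0 < α) (hαβ : α < β) :
    ∃ M : ℝ, 0 ≤ M ∧ ∀ e x y : ℝ, 0 < e → energy β x y ≤ 2 * e →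
      |x * y| ≤ M * (e * decayTime α β e) := by
  have hβ : 0 < β := hα.trans hαβ
  refine ⟨(2 * (β + 2)) ^ (1 / (β + 2)) * 2, by positivity, fun e x y he h => ?_⟩
  rw [abs_mul]
  calc |x| * |y| ≤ ((2 * (β + 2)) ^ (1 / (β + 2)) * e ^ (1 / (β + 2))) * (2 * e ^ (1 / 2 : ℝ)) :=
        mul_le_mul (abs_le_of_energy_le hβ he h) (abs_velocity_le_of_energy_le hβ he h)
          (abs_nonneg y) (by positivity)
    _ = (2 * (β + 2)) ^ (1 / (β + 2)) * 2 * (e ^ (1 / (β + 2)) * e ^ (1 / 2 : ℝ)) := by ring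
    _ ≤ _ := mul_le_mul_of_nonneg_left (rpow_boundary_le_decayTime hα hαβ he) (by positivity)

/-- If `B * X ^ p` exceeds `d`, then it is controlled by the higher power `X ^ (p + q)`. -/
theorem mul_rpow_le_add {B X p q d : ℝ} (hB : 0 < B) (hX : 0 ≤ X) (hp : 0 < p) (hq : 0 < q)
    (hd : 0 < d) : B * X ^ p ≤ d + B * (B / d) ^ (q / p) * X ^ (p + q) := by
  rcases le_or_gt (B * X ^ p) d with h | h
  · have : 0 ≤ B * (B / d) ^ (q / p) * X ^ (p + q) := by positivity
    linarith
  · have h1 : 1 ≤ (B / d) * X ^ p := by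
      rw [div_mul_eq_mul_div, le_div_iff₀ hd]; linarith
    have h2 : 1 ≤ (B / d) ^ (q / p) * X ^ q := by
      have := Real.one_le_rpow h1 (div_pos hq hp).le
      rwa [Real.mul_rpow (by positivity) (by positivity), ← Real.rpow_mul hX,
        mul_div_cancel₀ q hp.ne'] at this
    rw [Real.rpow_add' hX (by linarith)]
    have h3 : B * X ^ p * 1 ≤ B * X ^ p * ((B / d) ^ (q / p) * X ^ q) :=
      mul_le_mul_of_nonneg_left h2 (by positivity)
    nlinarith

theorem exists_absorb {α β : ℝ} (hα : 0 < α) (hαβ : α < β) (A : ℝ) (hA : 0 < A) :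
    ∃ K : ℝ, 0 ≤ K ∧ ∀ e x y : ℝ, 0 < e → energy β x y ≤ 2 * e →
      A * y ^ 2 + |x| * |y| ^ (α + 1) ≤ e + K * decayTime α β e * |y| ^ (α + 2) := by
  have hβ : 0 < β := hα.trans hαβ
  set R := (2 * (β + 2)) ^ (1 / (β + 2)) with hR
  have hR0 : 0 < R := by positivity
  refine ⟨A * (2 * A) ^ (α / 2) + R * (2 * R) ^ (1 / (α + 1)), by positivity,
    fun e x y he h => ?_⟩
  have h1 : A * y ^ 2 ≤ e / 2 + A * (2 * A) ^ (α / 2) * e ^ (-(α / 2)) * |y| ^ (α + 2) := by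
    have := mul_rpow_le_add hA (abs_nonneg y) two_pos hα (half_pos he)
    rw [Real.rpow_two, sq_abs, add_comm 2 α, show A / (e / 2) = 2 * A / e by field_simp,
      Real.div_rpow (by positivity) he.le, div_eq_mul_inv _ (e ^ _), ← Real.rpow_neg he.le] at this
    linarith
  have h2 : |x| * |y| ^ (α + 1) ≤ e / 2 + R * (2 * R) ^ (1 / (α + 1)) *
      e ^ (-((β - α) / ((β + 2) * (α + 1)))) * |y| ^ (α + 2) := by
    have h3 := mul_rpow_le_add (B := R * e ^ (1 / (β + 2))) (by positivity) (abs_nonneg y)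
      (by linarith : 0 < α + 1) one_pos (half_pos he)
    have h4 : R * e ^ (1 / (β + 2)) * (R * e ^ (1 / (β + 2)) / (e / 2)) ^ (1 / (α + 1)) =
        R * (2 * R) ^ (1 / (α + 1)) * e ^ (-((β - α) / ((β + 2) * (α + 1)))) := by
      have h5 : R * e ^ (1 / (β + 2)) / (e / 2) = 2 * R * e ^ (1 / (β + 2) - 1) := by
        rw [Real.rpow_sub_one he.ne']; field_simp
      rw [h5, Real.mul_rpow (by positivity) (by positivity), ← Real.rpow_mul he.le]
      have h6 : -((β - α) / ((β + 2) * (α + 1))) =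
          1 / (β + 2) + (1 / (β + 2) - 1) * (1 / (α + 1)) := by
        have : β + 2 ≠ 0 := by positivity
        have : α + 1 ≠ 0 := by positivity
        field_simp; ring
      rw [h6, Real.rpow_add he]; ring
    rw [h4, show α + 1 + 1 = α + 2 by ring] at h3
    exact (mul_le_mul_of_nonneg_right (abs_le_of_energy_le hβ he h) (by positivity)).trans h3
  have h7 : A * (2 * A) ^ (α / 2) * e ^ (-(α / 2)) * |y| ^ (α + 2) ≤
      A * (2 * A) ^ (α / 2) * decayTime α β e * |y| ^ (α + 2) := by
    unfold decayTime; gcongr; exact le_max_left _ _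
  have h8 : R * (2 * R) ^ (1 / (α + 1)) *
      e ^ (-((β - α) / ((β + 2) * (α + 1)))) * |y| ^ (α + 2) ≤
      R * (2 * R) ^ (1 / (α + 1)) * decayTime α β e * |y| ^ (α + 2) := by
    unfold decayTime; gcongr; exact le_max_right _ _
  linarith

theorem hasDerivAt_energy {α β : ℝ} (hα : 0 < α) (hβ : 0 < β) {u v : ℝ → ℝ} {t : ℝ}
    (hu : HasDerivAt u (v t) t)
    (hv : HasDerivAt v (-(|v t| ^ α * v t) - |u t| ^ β * u t) t) :
    HasDerivAt (fun s => energy β (u s) (v s)) (-|v t| ^ (α + 2)) t := by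
  have hb : β + 2 ≠ 0 := by linarith
  have h1 := (hasDerivAt_abs_rpow (u t) (by linarith : 1 < β + 2)).comp t hu
  have h2 := ((hv.pow 2).const_mul (1 / 2 : ℝ)).add (h1.div_const (β + 2))
  refine h2.congr_deriv ?_
  rw [← abs_rpow_mul_sq hα, add_sub_cancel_right]
  field_simp
  push_cast
  ring

theorem antitoneOn_energy {α β : ℝ} (hα : 0 < α) (hβ : 0 < β) {u v : ℝ → ℝ}
    (hu : ∀ t > 0, HasDerivAt u (v t) t)
    (hv : ∀ t > 0, HasDerivAt v (-(|v t| ^ α * v t) - |u t| ^ β * u t) t) :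
    AntitoneOn (fun s => energy β (u s) (v s)) (Ioi 0) := by
  have hE := fun t (ht : 0 < t) => hasDerivAt_energy hα hβ (hu t ht) (hv t ht)
  refine antitoneOn_of_deriv_nonpos (convex_Ioi 0)
    (fun t ht => (hE t ht).continuousAt.continuousWithinAt) ?_ ?_
  · rw [interior_Ioi]
    exact fun t ht => (hE t ht).differentiableAt.differentiableWithinAt
  · rw [interior_Ioi]
    intro t ht
    rw [(hE t ht).deriv]
    exact neg_nonpos.2 (by positivity)

/-- The time needed to halve the energy, down to the level `e`, is at most of the order of
`decayTime α β e`. -/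
theorem exists_halving_time_le {α β : ℝ} (hα : 0 < α) (hαβ : α < β) :
    ∃ C : ℝ, 0 < C ∧ ∀ u v : ℝ → ℝ, (∀ t > 0, HasDerivAt u (v t) t) →
      (∀ t > 0, HasDerivAt v (-(|v t| ^ α * v t) - |u t| ^ β * u t) t) →
      ∀ s t : ℝ, 0 < s → s ≤ t → 0 < energy β (u t) (v t) →
        energy β (u s) (v s) ≤ 2 * energy β (u t) (v t) →
        t - s ≤ C * decayTime α β (energy β (u t) (v t)) := by
  have hβ : 0 < β := hα.trans hαβ
  obtain ⟨M, hM, hM'⟩ := exists_abs_mul_abs_le hα hαβ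
  obtain ⟨K, hK, hK'⟩ := exists_absorb hα hαβ (1 + (β + 2) / 2) (by positivity)
  refine ⟨2 * M + 2 * K + 1, by positivity, fun u v hu hv s t hs hst he hle => ?_⟩
  set e := energy β (u t) (v t) with he'
  set T := decayTime α β e with hT
  have hT0 : 0 < T := decayTime_pos α β he
  have hanti := antitoneOn_energy hα hβ hu hv
  have hG : ∀ r > 0, HasDerivAt (fun r => u r * v r + K * T * energy β (u r) (v r) + e * r)
      (v r * v r + u r * (-(|v r| ^ α * v r) - |u r| ^ β * u r)
        + K * T * (-|v r| ^ (α + 2)) + e * 1) r := fun r hr =>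
    (((hu r hr).mul (hv r hr)).add ((hasDerivAt_energy hα hβ (hu r hr) (hv r hr)).const_mul _)).add
      ((hasDerivAt_id r).const_mul e)
  have hGanti : AntitoneOn (fun r => u r * v r + K * T * energy β (u r) (v r) + e * r)
      (Icc s t) := by
    refine antitoneOn_of_deriv_nonpos (convex_Icc s t)
      (fun r hr => (hG r (hs.trans_le hr.1)).continuousAt.continuousWithinAt) ?_ ?_
    · rw [interior_Icc]
      exact fun r hr => (hG r (hs.trans hr.1)).differentiableAt.differentiableWithinAt
    · rw [interior_Icc]
      intro r hr
      have hr0 : 0 < r := hs.trans hr.1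
      rw [(hG r hr0).deriv]
      have h1 : energy β (u r) (v r) ≤ 2 * e := (hanti hs hr0 hr.1.le).trans hle
      have h2 : e ≤ energy β (u r) (v r) := hanti hr0 (hs.trans_le hst) hr.2.le
      have h3 := hK' e (u r) (v r) he h1
      have h4 : -(u r * (|v r| ^ α * v r)) ≤ |u r| * |v r| ^ (α + 1) := by
        refine (neg_le_abs _).trans_eq ?_
        rw [abs_mul, abs_mul, abs_of_nonneg (by positivity : 0 ≤ |v r| ^ α), abs_mul_abs_rpow hα]
      have h5 : u r * (|u r| ^ β * u r) = |u r| ^ (β + 2) := by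
        rw [← abs_rpow_mul_sq hβ]; ring
      have h6 : |u r| ^ (β + 2) = (β + 2) * (energy β (u r) (v r) - (1 / 2) * v r ^ 2) := by
        unfold energy; field_simp; ring
      nlinarith [mul_le_mul_of_nonneg_left h2 (by linarith : 0 ≤ β + 2), mul_pos hβ he]
  have hfin := hGanti (left_mem_Icc.2 hst) (right_mem_Icc.2 hst) hst
  have hs1 := (abs_le.1 (hM' e (u s) (v s) he hle)).2
  have ht1 := (abs_le.1 (hM' e (u t) (v t) he (by linarith))).1
  have h7 : K * T * energy β (u s) (v s) ≤ K * T * (2 * e) := by gcongr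
  have h8 : 0 ≤ K * T * e := by positivity
  have h9 : 0 ≤ T * e := by positivity
  simp only [← he'] at hfin
  refine le_of_mul_le_mul_left ?_ he
  nlinarith

theorem exists_decayTime_two_mul_le {α β : ℝ} (hα : 0 < α) (hαβ : α < β) :
    ∃ θ : ℝ, θ < 1 ∧ ∀ e > 0, decayTime α β (2 * e) ≤ θ * decayTime α β e := by
  have hq : 0 < (β - α) / ((β + 2) * (α + 1)) := by
    have : 0 < β := hα.trans hαβ
    have := sub_pos.2 hαβ
    positivity
  refine ⟨max (2 ^ (-(α / 2))) (2 ^ (-((β - α) / ((β + 2) * (α + 1))))), max_lt ?_ ?_,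
    fun e he => ?_⟩
  · exact Real.rpow_lt_one_of_one_lt_of_neg one_lt_two (by linarith)
  · exact Real.rpow_lt_one_of_one_lt_of_neg one_lt_two (by linarith)
  · unfold decayTime
    rw [Real.mul_rpow two_pos.le he.le, Real.mul_rpow two_pos.le he.le]
    refine max_le ?_ ?_
    · gcongr <;> exact le_max_left _ _
    · gcongr <;> exact le_max_right _ _

theorem exists_elapsed_time_le {α β : ℝ} (hα : 0 < α) (hαβ : α < β) :
    ∃ C : ℝ, 0 < C ∧ ∀ u v : ℝ → ℝ, (∀ t > 0, HasDerivAt u (v t) t) →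
      (∀ t > 0, HasDerivAt v (-(|v t| ^ α * v t) - |u t| ^ β * u t) t) →
      ∀ s t : ℝ, 0 < s → s ≤ t → 0 < energy β (u t) (v t) →
        t - s ≤ C * decayTime α β (energy β (u t) (v t)) := by
  have hβ : 0 < β := hα.trans hαβ
  obtain ⟨C, hC, hC'⟩ := exists_halving_time_le hα hαβ
  obtain ⟨θ, hθ, hθ'⟩ := exists_decayTime_two_mul_le hα hαβ
  have hθ0 : 0 < θ := by
    have h1 := hθ' 1 one_pos
    have h2 := decayTime_pos α β (e := 2 * 1) (by norm_num)
    exact pos_of_mul_pos_left (h2.trans_le h1) (decayTime_pos α β one_pos).le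
  have hθsub : 0 < 1 - θ := by linarith
  refine ⟨C / (1 - θ), by positivity, fun u v hu hv s t hs hst he => ?_⟩
  have hstep : ∀ n : ℕ, ∀ t, s ≤ t → 0 < energy β (u t) (v t) →
      energy β (u s) (v s) ≤ 2 ^ (n + 1) * energy β (u t) (v t) →
      t - s ≤ C / (1 - θ) * decayTime α β (energy β (u t) (v t)) := by
    have hbase : ∀ t, s ≤ t → 0 < energy β (u t) (v t) →
        energy β (u s) (v s) ≤ 2 * energy β (u t) (v t) →
        t - s ≤ C / (1 - θ) * decayTime α β (energy β (u t) (v t)) := by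
      intro t hst he h
      refine (hC' u v hu hv s t hs hst he h).trans ?_
      refine mul_le_mul_of_nonneg_right ?_ (decayTime_pos α β he).le
      exact le_div_self hC.le hθsub (by linarith)
    intro n
    induction n with
    | zero => intro t hst he h; exact hbase t hst he (by simpa using h)
    | succ n ih =>
      intro t hst he h
      rcases le_or_gt (energy β (u s) (v s)) (2 * energy β (u t) (v t)) with h2 | h2
      · exact hbase t hst he h2
      · have hcont : ContinuousOn (fun r => energy β (u r) (v r)) (Icc s t) := fun r hr =>
          (hasDerivAt_energy hα hβ (hu r (hs.trans_le hr.1))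
            (hv r (hs.trans_le hr.1))).continuousAt.continuousWithinAt
        obtain ⟨r, hr, hr'⟩ := intermediate_value_Icc' hst hcont
          (show 2 * energy β (u t) (v t) ∈ _ from ⟨by linarith, h2.le⟩)
        simp only at hr'
        have h3 := ih r hr.1 (by rw [hr']; positivity) (by rw [hr']; rw [pow_succ] at h; linarith)
        have h4 := hC' u v hu hv r t (hs.trans_le hr.1) hr.2 he hr'.le
        rw [hr'] at h3
        have h5 := mul_le_mul_of_nonneg_left (hθ' _ he) (by positivity : 0 ≤ C / (1 - θ))
        have h6 : C / (1 - θ) * (θ * decayTime α β (energy β (u t) (v t))) +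
            C * decayTime α β (energy β (u t) (v t)) =
            C / (1 - θ) * decayTime α β (energy β (u t) (v t)) := by
          field_simp; ring
        linarith
  obtain ⟨n, hn⟩ := pow_unbounded_of_one_lt (energy β (u s) (v s) / energy β (u t) (v t))
    one_lt_two
  refine hstep n t hst he ?_
  rw [div_lt_iff₀ he] at hn
  rw [pow_succ]
  nlinarith [mul_pos (pow_pos (two_pos (α := ℝ)) n) he]

theorem le_rpow_of_le_rpow {C e p t : ℝ} (hC : 0 < C) (he : 0 < e) (hp : 0 < p) (ht : 0 < t)
    (h : t ≤ C * e ^ (-p)) : e ≤ C ^ (1 / p) * t ^ (-(1 / p)) := by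
  rw [Real.rpow_neg he.le, ← div_eq_mul_inv, le_div_iff₀ (by positivity)] at h
  have h1 : e ^ p ≤ C / t := by rw [le_div_iff₀ ht]; linarith
  rw [Real.rpow_neg ht.le, ← div_eq_mul_inv, ← Real.div_rpow hC.le ht.le, one_div]
  exact (Real.le_rpow_inv_iff_of_pos he.le (by positivity) hp).2 h1

/-- Optimal universal decay estimate for solutions of the scalar ODE
`u'' + |u'|^α u' + |u|^β u = 0` in the regime `0 < α < β`:
`E(t) ≤ C max {t^{-2/α}, t^{-(α+1)(β+2)/(β-α)}}` with `C` independent of the solution. -/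
theorem stmt_17 (α β : ℝ) (hα : 0 < α) (hαβ : α < β) :
    ∃ C : ℝ, ∀ u : ℝ → ℝ,
      (∀ t > (0:ℝ), DifferentiableAt ℝ u t) →
      (∀ t > (0:ℝ), DifferentiableAt ℝ (deriv u) t) →
      (∀ t > (0:ℝ),
        deriv (deriv u) t + |deriv u t| ^ α * deriv u t + |u t| ^ β * u t = 0) →
      ∀ t > (0:ℝ),
        (1 / 2) * (deriv u t) ^ 2 + |u t| ^ (β + 2) / (β + 2)
          ≤ C * max (t ^ (-(2 / α))) (t ^ (-((α + 1) * (β + 2) / (β - α)))) := by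
  have hβ : 0 < β := hα.trans hαβ
  have hsub : 0 < β - α := sub_pos.2 hαβ
  obtain ⟨C, hC, hC'⟩ := exists_elapsed_time_le hα hαβ
  refine ⟨max (C ^ (2 / α)) (C ^ ((α + 1) * (β + 2) / (β - α))),
    fun u hu hu' hode t ht => ?_⟩
  change energy β (u t) (deriv u t) ≤ _
  rcases (energy_nonneg hβ (u t) (deriv u t)).eq_or_lt with h0 | he
  · rw [← h0]; positivity
  have hv : ∀ t > 0, HasDerivAt (deriv u) (-(|deriv u t| ^ α * deriv u t) - |u t| ^ β * u t) t :=
    fun t ht => (hu' t ht).hasDerivAt.congr_deriv (by linarith [hode t ht])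
  have hT : t ≤ C * decayTime α β (energy β (u t) (deriv u t)) := by
    refine le_of_forall_pos_le_add fun ε hε => ?_
    have h1 := hC' u (deriv u) (fun t ht => (hu t ht).hasDerivAt) hv (min ε t) t (lt_min hε ht)
      (min_le_right _ _) he
    linarith [min_le_left ε t]
  rw [decayTime, mul_max_of_nonneg _ _ hC.le, le_max_iff] at hT
  rcases hT with h | h
  · have h1 := le_rpow_of_le_rpow hC he (by positivity) ht h
    rw [one_div_div] at h1
    refine h1.trans ?_
    gcongr <;> exact le_max_left _ _
  · have h1 := le_rpow_of_le_rpow hC he (by positivity) ht h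
    rw [one_div_div, mul_comm (β + 2)] at h1
    refine h1.trans ?_
    gcongr <;> exact le_max_right _ _
end
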